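/- Let x_0, …, x_T be a path in G with x_0 = v0 and T ≥ 1, let N := (N_e(x_0^T))_{e∈E} be its undirected edge-count vector, and let x_T be its endpoint. Then, as measures on the pinned space {w ∈ (0,∞)^E : w_{e0}=1}, the measure obtained from μ_{v0,A} by multiplying by the quenched path likelihood w ↦ ∏_{t=1}^T p_{x_{t−1} x_t}(w) equals (Z_{x_T, A+N} / Z_{v0,A}) · μ_{x_T, A+N}. In particular, the posterior law of the environment given X_0^T = x_0^T is μ_{x_T, A+N}: the parameters are updated by adding the undirected edge counts and moving the root to the endpoint of the path. -/

import Mathlib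

open MeasureTheory Real Filter
open scoped ENNReal NNReal Classical BigOperators

noncomputable section

namespace ERRW

variable {V : Type*} [Fintype V] [DecidableEq V]

/-- Total weight at a vertex: sum of the edge weights over the edges incident to `i`. -/
def vw (G : SimpleGraph V) [DecidableRel G.Adj] (w : Sym2 V → ℝ) (i : V) : ℝ :=
  ∑ j ∈ G.neighborFinset i, w s(i, j)

/-- Product of a vertex function over the two endpoints of an unordered pair. -/
def sprod (f : V → ℝ) : Sym2 V → ℝ :=
  Sym2.lift ⟨fun i j => f i * f j, fun i j => mul_comm _ _⟩

/-- Sum of a vertex function over the two endpoints of an unordered pair. -/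
def ssum (f : V → ℝ) : Sym2 V → ℝ :=
  Sym2.lift ⟨fun i j => f i + f j, fun i j => add_comm _ _⟩

/-- Quenched transition probability `p_{ij}(w) = w_{ij}/w_i`. -/
def qstep (G : SimpleGraph V) [DecidableRel G.Adj] (w : Sym2 V → ℝ) (i j : V) : ℝ :=
  if G.Adj i j then w s(i, j) / vw G w i else 0

/-- Stationary distribution `π_i(w) = w_i / Σ_v w_v` of the quenched chain. -/
def statDist (G : SimpleGraph V) [DecidableRel G.Adj] (w : Sym2 V → ℝ) (i : V) : ℝ :=
  vw G w i / ∑ v : V, vw G w v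

/-- Spanning trees of `G`, as edge sets. -/
def spanningTrees (G : SimpleGraph V) [DecidableRel G.Adj] : Finset (Finset (Sym2 V)) :=
  G.edgeFinset.powerset.filter fun F =>
    (SimpleGraph.fromEdgeSet (F : Set (Sym2 V))).IsTree

/-- Spanning-tree polynomial `τ(w) = Σ_{T} Π_{e ∈ T} w_e`. -/
def tau (G : SimpleGraph V) [DecidableRel G.Adj] (w : Sym2 V → ℝ) : ℝ :=
  ∑ F ∈ spanningTrees G, ∏ e ∈ F, w e

/-- Vertex parameter `b_v = (B_v + 1 - 𝟙(v = x))/2`. -/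
def bwt (G : SimpleGraph V) [DecidableRel G.Adj] (x : V) (B : Sym2 V → ℝ) (v : V) : ℝ :=
  (vw G B v + 1 - if v = x then 1 else 0) / 2

/-- The normalizing constant `Z_{x,B}` of the magic formula. -/
def Znorm (G : SimpleGraph V) [DecidableRel G.Adj] (x : V) (B : Sym2 V → ℝ) : ℝ :=
  ((∏ e ∈ G.edgeFinset, Real.Gamma (B e)) /
      ∏ v : V, Real.Gamma (bwt G x B v)) *
    Real.pi ^ (((Fintype.card V : ℝ) - 1) / 2) /
    2 ^ ((1 : ℝ) - (Fintype.card V : ℝ) + ∑ e ∈ G.edgeFinset, B e)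

/-- The magic-formula density of `μ_{x,B}` with respect to `Π_{e ≠ e0} dw_e`. -/
def magicDensity (G : SimpleGraph V) [DecidableRel G.Adj] (x : V) (B : Sym2 V → ℝ)
    (w : Sym2 V → ℝ) : ℝ :=
  (Znorm G x B)⁻¹ * (vw G w x) ^ ((1 : ℝ) / 2) *
      (∏ e ∈ G.edgeFinset, w e ^ (B e - 1)) /
      (∏ v : V, (vw G w v) ^ ((vw G B v + 1) / 2)) *
    Real.sqrt (tau G w)

/-- Coordinates indexed by the non-reference edges. -/
abbrev Epin (G : SimpleGraph V) [DecidableRel G.Adj] (e0 : Sym2 V) :=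
  {e : Sym2 V // e ∈ G.edgeFinset ∧ e ≠ e0}

/-- Extension of non-reference edge coordinates to a pinned environment (`w_{e0} = 1`). -/
def pinExt (G : SimpleGraph V) [DecidableRel G.Adj] (e0 : Sym2 V)
    (u : Epin G e0 → ℝ) : Sym2 V → ℝ :=
  fun e => if e = e0 then 1 else if h : e ∈ G.edgeFinset ∧ e ≠ e0 then u ⟨e, h⟩ else 0

/-- The mixing measure `μ_{x,B}` of the magic formula, as a measure on
environments pinned at the reference edge `e0`. -/
def mixing (G : SimpleGraph V) [DecidableRel G.Adj] (e0 : Sym2 V) (x : V) (B : Sym2 V → ℝ) :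
    Measure (Sym2 V → ℝ) :=
  Measure.map (pinExt G e0)
    ((volume : Measure (Epin G e0 → ℝ)).withDensity fun u =>
      ENNReal.ofReal
        (if ∀ e ∈ G.edgeFinset, 0 < pinExt G e0 u e then
          magicDensity G x B (pinExt G e0 u) else 0))

/-- Kullback–Leibler divergence (natural logarithm), `+∞` if `P` is not
absolutely continuous with respect to `Q`. -/
def KL {Ω : Type*} [MeasurableSpace Ω] (P Q : Measure Ω) : EReal :=
  if P ≪ Q then ((∫ x, Real.log (P.rnDeriv Q x).toReal ∂P : ℝ) : EReal) else ⊤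

/-- Edge local time (current edge weight) at time `t` along a path. -/
def localTime (a : Sym2 V → ℝ) (x : ℕ → V) (t : ℕ) (e : Sym2 V) : ℝ :=
  a e + ((Finset.range t).filter fun k => s(x k, x (k + 1)) = e).card

/-- One-step ERRW conditional probability at time `t` given the past of the path. -/
def errwStep (G : SimpleGraph V) [DecidableRel G.Adj] (a : Sym2 V → ℝ) (x : ℕ → V)
    (t : ℕ) : ℝ :=
  if G.Adj (x t) (x (t + 1)) then
    localTime a x t s(x t, x (t + 1)) /
      ∑ u ∈ G.neighborFinset (x t), localTime a x t s(x t, u)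
  else 0

/-- Extension of a finite path to ℕ (junk value `v0` beyond time `T`). -/
def extendPath {T : ℕ} (v0 : V) (x : Fin (T + 1) → V) : ℕ → V :=
  fun t => if h : t < T + 1 then x ⟨t, h⟩ else v0

/-- ERRW trajectory probability of a length-`T` path (the trajectory law mass function). -/
def errwProb (G : SimpleGraph V) [DecidableRel G.Adj] (v0 : V) (a : Sym2 V → ℝ) (T : ℕ)
    (x : Fin (T + 1) → V) : ℝ :=
  if x 0 = v0 then ∏ t ∈ Finset.range T, errwStep G a (extendPath v0 x) t else 0

/-- Undirected traversal count `N_e` of an edge along a finite path. -/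
def edgeCount {T : ℕ} (v0 : V) (x : Fin (T + 1) → V) (e : Sym2 V) : ℕ :=
  ((Finset.range T).filter fun k =>
    s(extendPath v0 x k, extendPath v0 x (k + 1)) = e).card

/-- Quenched path probability of a length-`T` path started at `v0`. -/
def quenchedProb (G : SimpleGraph V) [DecidableRel G.Adj] (v0 : V) (w : Sym2 V → ℝ) (T : ℕ)
    (x : Fin (T + 1) → V) : ℝ :=
  if x 0 = v0 then
    ∏ t ∈ Finset.range T, qstep G w (extendPath v0 x t) (extendPath v0 x (t + 1))
  else 0

/-- The measure on a finite type determined by a mass function. -/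
def discreteMeasure {Ω : Type*} [Fintype Ω] [MeasurableSpace Ω] (p : Ω → ℝ) : Measure Ω :=
  ∑ x : Ω, ENNReal.ofReal (p x) • Measure.dirac x

/-- Digamma function `Ψ = (log Γ)'`. -/
def digamma (x : ℝ) : ℝ := deriv (fun y => Real.log (Real.Gamma y)) x

/-- Trigamma function `Ψ₁ = Ψ'`. -/
def trigamma (x : ℝ) : ℝ := deriv digamma x

/-- `Λ(p,q) = log Γ(q) − log Γ(p) − (q−p)·Ψ(p)`. -/
def Lam (p q : ℝ) : ℝ :=
  Real.log (Real.Gamma q) - Real.log (Real.Gamma p) - (q - p) * digamma p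

/-- The multiplicative Haar measure `dx / x` on the positive half-line, as a measure on `ℝ`. -/
def mulHaar : Measure ℝ :=
  (volume.restrict (Set.Ioi 0)).withDensity fun x => ENNReal.ofReal x⁻¹

instance : SigmaFinite mulHaar := by unfold mulHaar; infer_instance

theorem lintegral_mulHaar_eq_setLIntegral (f : ℝ → ℝ≥0∞) :
    ∫⁻ x, f x ∂mulHaar = ∫⁻ x in Set.Ioi 0, ENNReal.ofReal x⁻¹ * f x := by
  unfold mulHaar
  rw [lintegral_withDensity_eq_lintegral_mul_non_measurable _ (by fun_prop)
    (by simp)]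
  rfl

theorem lintegral_mulHaar_eq_lintegral_exp (f : ℝ → ℝ≥0∞) :
    ∫⁻ x, f x ∂mulHaar = ∫⁻ y, f (Real.exp y) := by
  rw [lintegral_mulHaar_eq_setLIntegral]
  have h := lintegral_image_eq_lintegral_abs_deriv_mul (s := Set.univ) (f := Real.exp)
    (f' := Real.exp) MeasurableSet.univ
    (fun x _ => (Real.hasDerivAt_exp x).hasDerivWithinAt) Real.exp_injective.injOn
    (fun x => ENNReal.ofReal x⁻¹ * f x)
  rw [Set.image_univ, Real.range_exp] at h
  rw [h, Measure.restrict_univ]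
  refine lintegral_congr fun y => ?_
  rw [← mul_assoc, ← ENNReal.ofReal_mul (abs_nonneg _), abs_of_pos (Real.exp_pos y),
    mul_inv_cancel₀ (Real.exp_pos y).ne', ENNReal.ofReal_one, one_mul]

theorem ae_mulHaar_pos : ∀ᵐ x ∂mulHaar, 0 < x := by
  unfold mulHaar
  exact (withDensity_absolutelyContinuous _ _).ae_le (ae_restrict_mem measurableSet_Ioi)

theorem measurePreserving_mul_mulHaar {c : ℝ} (hc : 0 < c) :
    MeasurePreserving (fun x => c * x) mulHaar mulHaar := by
  refine ⟨by fun_prop, Measure.ext_of_lintegral _ fun f hf => ?_⟩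
  rw [lintegral_map hf (by fun_prop), lintegral_mulHaar_eq_lintegral_exp,
    lintegral_mulHaar_eq_lintegral_exp,
    ← lintegral_add_right_eq_self (fun y => f (Real.exp y)) (Real.log c)]
  simp_rw [Real.exp_add, Real.exp_log hc, mul_comm]

theorem ae_pi_mulHaar_pos {ι : Type*} [Fintype ι] :
    ∀ᵐ x ∂(Measure.pi fun _ : ι => mulHaar), ∀ i, 0 < x i := by
  rw [ae_all_iff]
  exact fun i => (Measure.tendsto_eval_ae_ae (i := i)).eventually ae_mulHaar_pos

theorem measurePreserving_mul_pi_mulHaar {ι : Type*} [Fintype ι] {c : ι → ℝ}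
    (hc : ∀ i, 0 < c i) :
    MeasurePreserving (fun (x : ι → ℝ) i => c i * x i) (Measure.pi fun _ : ι => mulHaar)
      (Measure.pi fun _ : ι => mulHaar) :=
  measurePreserving_pi (fun _ => mulHaar) (fun _ => mulHaar)
    (f := fun i x => c i * x) fun i => measurePreserving_mul_mulHaar (hc i)

theorem lintegral_pi_finset_prod_fin {n : ℕ} (μ : Measure ℝ) [SigmaFinite μ]
    (f : Fin n → ℝ → ℝ≥0∞) (hf : ∀ i, Measurable (f i)) :
    ∫⁻ x, ∏ i, f i (x i) ∂(Measure.pi fun _ : Fin n => μ) = ∏ i, ∫⁻ x, f i x ∂μ := by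
  induction n with
  | zero => simp
  | succ n ih =>
    have h := (measurePreserving_piFinSuccAbove (fun _ : Fin (n + 1) => μ) 0).symm
    rw [← h.lintegral_comp_emb (MeasurableEquiv.measurableEmbedding _), Fin.prod_univ_succ,
      ← ih (fun i => f i.succ) fun i => hf _, ← lintegral_prod_mul (hf 0).aemeasurable]
    · refine lintegral_congr fun z => ?_
      rw [Fin.prod_univ_succ]
      simp [MeasurableEquiv.piFinSuccAbove, Fin.insertNthEquiv]
    · exact (Finset.measurable_prod _ fun i _ =>
        (hf i.succ).comp (measurable_pi_apply i)).aemeasurable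

theorem lintegral_pi_comp_equiv {ι ι' : Type*} [Fintype ι] [Fintype ι'] (μ : Measure ℝ)
    [SigmaFinite μ] (e : ι' ≃ ι) (F : (ι' → ℝ) → ℝ≥0∞) :
    ∫⁻ x, F (fun i => x (e i)) ∂(Measure.pi fun _ : ι => μ) =
      ∫⁻ x, F x ∂(Measure.pi fun _ : ι' => μ) := by
  have h := measurePreserving_piCongrLeft (fun _ : ι => μ) e
  rw [← h.lintegral_comp_emb (MeasurableEquiv.measurableEmbedding _)]
  refine lintegral_congr fun z => ?_
  congr 1
  ext i
  exact congrArg _ rfl |>.trans (Equiv.piCongrLeft_apply_apply (fun _ : ι => ℝ) e z i)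

theorem lintegral_pi_finset_prod {ι : Type*} [Fintype ι] (μ : Measure ℝ) [SigmaFinite μ]
    (f : ι → ℝ → ℝ≥0∞) (hf : ∀ i, Measurable (f i)) :
    ∫⁻ x, ∏ i, f i (x i) ∂(Measure.pi fun _ : ι => μ) = ∏ i, ∫⁻ x, f i x ∂μ := by
  have e := (Fintype.equivFin ι).symm
  rw [← e.prod_comp, ← lintegral_pi_finset_prod_fin μ (fun i => f (e i)) fun i => hf _,
    ← lintegral_pi_comp_equiv μ e]
  refine lintegral_congr fun x => ?_
  rw [← e.prod_comp]

theorem lintegral_pi_mulHaar {ι : Type*} [Fintype ι] (F : (ι → ℝ) → ℝ≥0∞) (hF : Measurable F) :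
    ∫⁻ x, F x ∂(Measure.pi fun _ : ι => mulHaar) =
      ∫⁻ x in Set.univ.pi fun _ => Set.Ioi 0, (∏ i, ENNReal.ofReal (x i)⁻¹) * F x := by
  have hm : Measurable fun x : ι → ℝ => ∏ i, ENNReal.ofReal (x i)⁻¹ := by fun_prop
  have h : (Measure.pi fun _ : ι => mulHaar) =
      (volume.restrict (Set.univ.pi fun _ => Set.Ioi 0)).withDensity
        fun x : ι → ℝ => ∏ i, ENNReal.ofReal (x i)⁻¹ := by
    refine (Measure.pi_eq fun s hs => ?_)
    rw [withDensity_apply _ (MeasurableSet.univ_pi hs), volume_pi, Measure.restrict_pi_pi,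
      Measure.restrict_pi_pi]
    have : ∀ i, mulHaar (s i) = ∫⁻ x in s i, ENNReal.ofReal x⁻¹ ∂(volume.restrict (Set.Ioi 0)) :=
      fun i => withDensity_apply _ (hs i)
    simp_rw [this]
    have key := lintegral_pi_finset_prod (ι := ι) (volume.restrict (Set.Ioi 0))
      (fun i x => (s i).indicator (fun y => ENNReal.ofReal y⁻¹) x)
      fun i => Measurable.indicator (by fun_prop) (hs i)
    simp_rw [lintegral_indicator (hs _)] at key
    rw [← key, ← Measure.restrict_pi_pi, ← lintegral_indicator (MeasurableSet.univ_pi hs)]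
    refine lintegral_congr fun x => ?_
    by_cases hx : ∀ i, x i ∈ s i
    · rw [Set.indicator_of_mem (by simpa using hx)]
      exact Finset.prod_congr rfl fun i _ => by rw [Set.indicator_of_mem (hx i)]
    · rw [Set.indicator_of_notMem (by simpa using hx)]
      push Not at hx
      obtain ⟨i, hi⟩ := hx
      exact (Finset.prod_eq_zero (Finset.mem_univ i) (Set.indicator_of_notMem hi _)).symm
  rw [h, lintegral_withDensity_eq_lintegral_mul _ hm hF]
  rfl

theorem lintegral_mulHaar_rpow_mul_exp {p s b : ℝ} (hp : 0 < p) (hs : 0 < s) (hb : 0 < b) :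
    ∫⁻ x, ENNReal.ofReal (x ^ s * Real.exp (-b * x ^ p)) ∂mulHaar =
      ENNReal.ofReal (b ^ (-s / p) * (1 / p) * Real.Gamma (s / p)) := by
  have h := integral_rpow_mul_exp_neg_mul_rpow (q := s - 1) hp (by linarith) hb
  rw [sub_add_cancel] at h
  rw [lintegral_mulHaar_eq_setLIntegral, ← h, ofReal_integral_eq_lintegral_ofReal]
  · refine setLIntegral_congr_fun measurableSet_Ioi fun x hx => ?_
    have hx : 0 < x := hx
    rw [← ENNReal.ofReal_mul (by positivity), Real.rpow_sub_one hx.ne']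
    congr 1
    ring
  · by_contra hc
    rw [integral_undef hc] at h
    have := Real.Gamma_pos_of_pos (div_pos hs hp)
    have : 0 < b ^ (-s / p) * (1 / p) * Real.Gamma (s / p) := by positivity
    exact this.ne h
  · exact (ae_restrict_mem measurableSet_Ioi).mono fun x hx => by
      have hx : 0 < x := hx
      simp only [Pi.zero_apply]
      positivity

theorem lintegral_exp_neg_sq_div_two :
    ∫⁻ z : ℝ, ENNReal.ofReal (Real.exp (-z ^ 2 / 2)) = ENNReal.ofReal (√(2 * π)) := by
  have h := integral_gaussian (1 / 2)
  have hi := integrable_exp_neg_mul_sq (b := 1 / 2) (by norm_num)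
  have := ofReal_integral_eq_lintegral_ofReal hi (ae_of_all _ fun x => (Real.exp_pos _).le)
  rw [h] at this
  rw [show π / (1 / 2) = 2 * π by ring] at this
  rw [this]
  refine lintegral_congr fun z => ?_
  congr 2
  ring

theorem lintegral_mulHaar_inverseGaussian {q : ℝ} (hq : 0 < q) :
    ∫⁻ b, ENNReal.ofReal (√b * Real.exp (-(b / 2) - q ^ 2 / (2 * b) + q)) ∂mulHaar =
      ENNReal.ofReal (√(2 * π)) := by
  rw [← (measurePreserving_mul_mulHaar hq).lintegral_comp (by fun_prop),
    lintegral_mulHaar_eq_lintegral_exp]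
  set g : ℝ → ℝ := fun y => Real.exp (-(2 * √q * Real.sinh (y / 2)) ^ 2 / 2) with hg
  have hsq : √q ^ 2 = q := Real.sq_sqrt hq.le
  have h1 : ∀ y : ℝ, √(q * Real.exp y) *
      Real.exp (-(q * Real.exp y / 2) - q ^ 2 / (2 * (q * Real.exp y)) + q) =
        √q * Real.exp (y / 2) * g y := by
    intro y
    rw [Real.sqrt_mul hq.le, Real.exp_half, hg]
    congr 2
    have e1 : Real.exp y = Real.exp (y / 2) ^ 2 := by rw [← Real.exp_nat_mul]; congr 1; ring
    rw [e1, Real.sinh_eq, Real.exp_neg, mul_pow, mul_pow, hsq]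
    have := Real.exp_pos (y / 2)
    field_simp
    ring
  simp_rw [h1]
  set f : ℝ → ℝ≥0∞ := fun y => ENNReal.ofReal (√q * Real.exp (y / 2) * g y) with hf
  have hgm : Measurable g := by fun_prop
  have hfm : Measurable f := by fun_prop
  have hneg : ∫⁻ y, f (-y) = ∫⁻ y, f y := lintegral_neg_eq_self f
  have hsum : ∫⁻ y, (f y + f (-y)) = 2 * ENNReal.ofReal (√(2 * π)) := by
    have hz := lintegral_image_eq_lintegral_abs_deriv_mul (s := Set.univ)
      (f := fun y => 2 * √q * Real.sinh (y / 2)) (f' := fun y => √q * Real.cosh (y / 2))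
      MeasurableSet.univ (fun x _ => by
        have := (((Real.hasDerivAt_sinh (x / 2)).comp x
          ((hasDerivAt_id x).div_const 2)).const_mul (2 * √q))
        refine (this.congr_deriv ?_).hasDerivWithinAt
        ring)
      (by
        intro x _ y _ hxy
        have hq' : (2 * √q) ≠ 0 := by positivity
        have := Real.sinh_injective (mul_left_cancel₀ hq' hxy)
        linarith)
      (fun z => ENNReal.ofReal (Real.exp (-z ^ 2 / 2)))
    have hr : (fun y => 2 * √q * Real.sinh (y / 2)) '' Set.univ = Set.univ := by
      rw [Set.image_univ, Set.range_eq_univ]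
      intro z
      obtain ⟨y, hy⟩ := Real.sinh_surjective (z / (2 * √q))
      refine ⟨2 * y, ?_⟩
      have hq' : (2 * √q) ≠ 0 := by positivity
      simp only [mul_div_cancel_left₀ y (two_ne_zero' ℝ), hy]
      field_simp
    rw [hr, Measure.restrict_univ, lintegral_exp_neg_sq_div_two] at hz
    rw [hz, ← lintegral_const_mul _ (by fun_prop)]
    refine lintegral_congr fun y => ?_
    have hgy : g (-y) = g y := by
      simp only [hg]
      rw [neg_div 2 y, Real.sinh_neg]
      congr 1
      ring
    have hgp : 0 < g y := Real.exp_pos _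
    simp only [hf]
    rw [hgy, abs_of_pos (by positivity), ← ENNReal.ofReal_add (by positivity) (by positivity),
      ← ENNReal.ofReal_mul (by positivity), ← ENNReal.ofReal_ofNat,
      ← ENNReal.ofReal_mul (by positivity), Real.cosh_eq]
    congr 1
    rw [neg_div 2 y]
    simp only [hg]
    ring
  rw [lintegral_add_left hfm, hneg, ← two_mul] at hsum
  exact (ENNReal.mul_right_inj (by simp) (by simp)).1 hsum

theorem det_succ_eq_mul_det_schur {n : ℕ} (M : Matrix (Fin (n + 1)) (Fin (n + 1)) ℝ)
    (h : M 0 0 ≠ 0) :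
    M.det = M 0 0 *
      (Matrix.of fun i j : Fin n => M i.succ j.succ - M i.succ 0 * M 0 j.succ / M 0 0).det := by
  set B : Matrix (Fin (n + 1)) (Fin (n + 1)) ℝ := Matrix.of fun i j =>
    M i j - (Fin.cons 0 fun k : Fin n => M k.succ 0 / M 0 0 : Fin (n + 1) → ℝ) i * M 0 j with hB
  have hdet : M.det = B.det := by
    refine Matrix.det_eq_of_forall_row_eq_smul_add_const
      (Fin.cons 0 fun k : Fin n => M k.succ 0 / M 0 0) 0 (by simp) fun i j => ?_
    simp [hB]
  rw [hdet, Matrix.det_succ_column_zero, Finset.sum_eq_single 0]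
  · simp only [hB, Fin.val_zero, pow_zero, one_mul, Matrix.of_apply, Fin.cons_zero, zero_mul,
      sub_zero]
    congr 2
    ext i j
    simp [Matrix.submatrix]
    ring
  · intro i _ hi
    obtain ⟨k, rfl⟩ := Fin.exists_succ_eq.2 hi
    simp [hB, h]
  · simp

section Field

variable {ι : Type*} [Fintype ι] [DecidableEq ι]

/-- The Schrödinger-type matrix `diag(r_i (∑_k c_{ik} / r_k + η_i)) - c`. -/
def fieldMatrix (c : ι → ι → ℝ) (η r : ι → ℝ) : Matrix ι ι ℝ :=
  Matrix.diagonal (fun i => r i * (∑ k, c i k / r k + η i)) - Matrix.of c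

/-- The energy `∑_{ij} c_{ij} (cosh (u_i - u_j) - 1) + ∑_i η_i (cosh u_i - 1)` in the variables
`r_i = exp u_i`, the first sum being over unordered pairs. -/
def fieldEnergy (c : ι → ι → ℝ) (η r : ι → ℝ) : ℝ :=
  (∑ i, ∑ j, c i j * (r i / r j - 1)) / 2 + ∑ i, η i * ((r i + 1 / r i) / 2 - 1)

theorem measurable_det {α : Type*} [MeasurableSpace α] {A : α → Matrix ι ι ℝ}
    (hA : ∀ i j, Measurable fun x => A x i j) : Measurable fun x => (A x).det := by
  simp_rw [Matrix.det_apply]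
  exact Finset.measurable_sum _ fun σ _ =>
    (Finset.measurable_prod _ fun i _ => hA _ _).const_smul _

theorem measurable_fieldDensity {α : Type*} [MeasurableSpace α] {c : α → ι → ι → ℝ}
    {η r : α → ι → ℝ} (hc : ∀ i j, Measurable fun x => c x i j)
    (hη : ∀ i, Measurable fun x => η x i) (hr : ∀ i, Measurable fun x => r x i) :
    Measurable fun x => ENNReal.ofReal
      (√(fieldMatrix (c x) (η x) (r x)).det * Real.exp (-fieldEnergy (c x) (η x) (r x))) := by
  have h1 : Measurable fun x => (fieldMatrix (c x) (η x) (r x)).det := by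
    refine measurable_det fun i j => ?_
    simp only [fieldMatrix, Matrix.sub_apply, Matrix.diagonal_apply, Matrix.of_apply]
    split_ifs <;> fun_prop
  have h2 : Measurable fun x => fieldEnergy (c x) (η x) (r x) := by
    unfold fieldEnergy
    fun_prop
  fun_prop

end Field

section Elimination

variable {n : ℕ} (c : Fin (n + 1) → Fin (n + 1) → ℝ) (η : Fin (n + 1) → ℝ)

/-- Conductances after elimination of vertex `0` at level `b` (star-mesh transform). -/
def elimCond (b : ℝ) (i j : Fin n) : ℝ := c i.succ j.succ + c 0 i.succ * c 0 j.succ / b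

/-- Root conductances after elimination of vertex `0` at level `b`. -/
def elimRoot (b : ℝ) (i : Fin n) : ℝ := η i.succ + c 0 i.succ * η 0 / b

/-- The local field at vertex `0` generated by the remaining vertices. -/
def localField (r : Fin n → ℝ) : ℝ := ∑ j, c 0 j.succ / r j + η 0

variable {c η}

theorem det_fieldMatrix_cons (hs : ∀ i j, c i j = c j i) {b : ℝ} (hb : 0 < b)
    {r : Fin n → ℝ} (hS : 0 < localField c η r) :
    (fieldMatrix c η (Fin.cons ((localField c η r)⁻¹ * b) r)).det =
      b * (fieldMatrix (elimCond c b) (elimRoot c η b) r).det := by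
  have hS' := hS.ne'
  have h00 : fieldMatrix c η (Fin.cons ((localField c η r)⁻¹ * b) r) 0 0 = b := by
    simp only [fieldMatrix, Matrix.sub_apply, Matrix.diagonal_apply_eq, Matrix.of_apply,
      Fin.cons_zero, Fin.sum_univ_succ, Fin.cons_succ]
    rw [add_assoc, ← localField]
    field_simp
    ring
  rw [det_succ_eq_mul_det_schur _ (by rw [h00]; exact hb.ne'), h00]
  congr 2
  ext i j
  have hsum : ∑ k, elimCond c b i k / r k + elimRoot c η b i =
      ∑ k, c i.succ k.succ / r k + η i.succ + c 0 i.succ * localField c η r / b := by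
    simp only [elimCond, elimRoot, localField, add_div, Finset.sum_add_distrib, mul_add,
      Finset.mul_sum, Finset.sum_div]
    have : ∀ k, c 0 i.succ * c 0 k.succ / b / r k = c 0 i.succ * (c 0 k.succ / r k) / b :=
      fun k => by ring
    simp_rw [this]
    ring
  have hdiag : ∑ k, c i.succ k / (Fin.cons ((localField c η r)⁻¹ * b) r : Fin (n + 1) → ℝ) k
      + η i.succ = ∑ k, elimCond c b i k / r k + elimRoot c η b i := by
    rw [hsum, Fin.sum_univ_succ]
    simp only [Fin.cons_zero, Fin.cons_succ]
    rw [hs i.succ 0]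
    field_simp
    ring
  simp only [fieldMatrix, Matrix.sub_apply, Matrix.of_apply, Matrix.diagonal_apply,
    Fin.succ_inj, hdiag, Fin.cons_succ, Fin.succ_ne_zero, (Fin.succ_ne_zero _).symm, if_false]
  rw [hs i.succ 0, elimCond]
  ring

theorem fieldEnergy_cons (hs : ∀ i j, c i j = c j i) {b : ℝ} (hb : 0 < b)
    {r : Fin n → ℝ} (hS : 0 < localField c η r) :
    -fieldEnergy c η (Fin.cons ((localField c η r)⁻¹ * b) r) =
      (-(b / 2) - localField c η 1 ^ 2 / (2 * b) + localField c η 1) +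
        -fieldEnergy (elimCond c b) (elimRoot c η b) r := by
  set S := localField c η r with hSdef
  set q := localField c η 1 with hq
  have hS' := hS.ne'
  have hqe : q = ∑ j, c 0 (Fin.succ j) + η 0 := by simp [hq, localField]
  set R := ∑ j, c 0 (Fin.succ j) * r j with hR
  have hSe : ∑ j, c 0 (Fin.succ j) / r j = S - η 0 := by rw [hSdef, localField]; ring
  have hce : ∑ j, c 0 (Fin.succ j) = q - η 0 := by rw [hqe]; ring
  have e1 : ∑ i, ∑ j, elimCond c b i j * (r i / r j - 1) =
      ∑ i, ∑ j, c (Fin.succ i) (Fin.succ j) * (r i / r j - 1) +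
        (R * (S - η 0) - (q - η 0) ^ 2) / b := by
    rw [← hSe, ← hce, sq, hR, Finset.sum_mul_sum, Finset.sum_mul_sum, ← Finset.sum_sub_distrib,
      Finset.sum_div, ← Finset.sum_add_distrib]
    refine Finset.sum_congr rfl fun i _ => ?_
    rw [← Finset.sum_sub_distrib, Finset.sum_div, ← Finset.sum_add_distrib]
    refine Finset.sum_congr rfl fun j _ => ?_
    rw [elimCond]
    ring
  have e2 : ∑ i, elimRoot c η b i * ((r i + 1 / r i) / 2 - 1) =
      ∑ i, η (Fin.succ i) * ((r i + 1 / r i) / 2 - 1) +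
        η 0 / b * ((R + (S - η 0)) / 2 - (q - η 0)) := by
    rw [← hSe, ← hce, hR, ← Finset.sum_add_distrib, Finset.sum_div, ← Finset.sum_sub_distrib,
      Finset.mul_sum, ← Finset.sum_add_distrib]
    refine Finset.sum_congr rfl fun i _ => ?_
    rw [elimRoot]
    ring
  have e3 : ∑ j, c 0 (Fin.succ j) * (S⁻¹ * b / r j - 1) = S⁻¹ * b * (S - η 0) - (q - η 0) := by
    rw [← hSe, ← hce, Finset.mul_sum, ← Finset.sum_sub_distrib]
    exact Finset.sum_congr rfl fun i _ => by ring
  have e4 : ∑ i, c (Fin.succ i) 0 * (r i / (S⁻¹ * b) - 1) = R / (S⁻¹ * b) - (q - η 0) := by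
    rw [← hce, hR, Finset.sum_div, ← Finset.sum_sub_distrib]
    exact Finset.sum_congr rfl fun i _ => by rw [hs]; ring
  have hSb : S⁻¹ * b ≠ 0 := by positivity
  simp only [fieldEnergy, Fin.sum_univ_succ, Fin.cons_zero, Fin.cons_succ,
    Finset.sum_add_distrib, e1, e2, e3, e4, div_self hSb, sub_self, mul_zero, zero_add]
  field_simp
  ring

theorem localField_pos (hc : ∀ i j, 0 ≤ c i j) (hη : ∀ i, 0 ≤ η i)
    (hdet : ∀ r, (∀ i, 0 < r i) → 0 < (fieldMatrix c η r).det) {r : Fin n → ℝ}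
    (hr : ∀ i, 0 < r i) : 0 < localField c η r := by
  have hnn : ∀ j ∈ Finset.univ, 0 ≤ c 0 (Fin.succ j) / r j :=
    fun j _ => div_nonneg (hc _ _) (hr j).le
  have h0 : 0 ≤ localField c η r := add_nonneg (Finset.sum_nonneg hnn) (hη 0)
  refine h0.lt_of_ne fun h => ?_
  have hd := hdet (Fin.cons 1 r) fun i => by
    refine Fin.cases ?_ (fun i => ?_) i <;> simp [hr]
  have hsum : ∑ j, c 0 (Fin.succ j) / r j = 0 := by
    have := Finset.sum_nonneg hnn
    have := hη 0
    rw [localField] at h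
    linarith
  have hz : ∀ j, c 0 (Fin.succ j) = 0 := fun j => by
    have := (Finset.sum_eq_zero_iff_of_nonneg hnn).1 hsum j (Finset.mem_univ j)
    exact (div_eq_zero_iff.1 this).resolve_right (hr j).ne'
  refine hd.ne' (Matrix.det_eq_zero_of_row_eq_zero 0 fun j => ?_)
  refine Fin.cases ?_ (fun j => ?_) j
  · simp only [fieldMatrix, Matrix.sub_apply, Matrix.diagonal_apply_eq, Matrix.of_apply,
      Fin.cons_zero, Fin.sum_univ_succ, Fin.cons_succ]
    rw [add_assoc, ← localField, ← h]
    ring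
  · simp [fieldMatrix, hz, (Fin.succ_ne_zero j).symm]

theorem lintegral_mul_lintegral_swap {α β : Type*} [MeasurableSpace α] [MeasurableSpace β]
    {μ : Measure α} {ν : Measure β} [SFinite μ] [SFinite ν] {g : α → ℝ≥0∞} {f : α × β → ℝ≥0∞}
    (hg : Measurable g) (hf : Measurable f) :
    ∫⁻ a, g a * ∫⁻ b, f (a, b) ∂ν ∂μ = ∫⁻ b, ∫⁻ a, g a * f (a, b) ∂μ ∂ν := by
  rw [← lintegral_lintegral_swap ((hg.comp measurable_fst).mul hf).aemeasurable]
  exact lintegral_congr fun a => (lintegral_const_mul _ (hf.comp measurable_prodMk_left)).symm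

theorem lintegral_fieldDensity_succ (hs : ∀ i j, c i j = c j i) (hc : ∀ i j, 0 ≤ c i j)
    (hη : ∀ i, 0 ≤ η i) (hdet : ∀ r, (∀ i, 0 < r i) → 0 < (fieldMatrix c η r).det) :
    ∫⁻ r, ENNReal.ofReal (√(fieldMatrix c η r).det * Real.exp (-fieldEnergy c η r))
        ∂(Measure.pi fun _ => mulHaar) =
      ∫⁻ b, ENNReal.ofReal (√b * Real.exp (-(b / 2) - localField c η 1 ^ 2 / (2 * b) +
          localField c η 1)) *
        ∫⁻ r, ENNReal.ofReal (√(fieldMatrix (elimCond c b) (elimRoot c η b) r).det *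
          Real.exp (-fieldEnergy (elimCond c b) (elimRoot c η b) r))
          ∂(Measure.pi fun _ => mulHaar) ∂mulHaar := by
  have hpres := (measurePreserving_piFinSuccAbove (fun _ : Fin (n + 1) => mulHaar) 0).symm
  have hcons : ∀ z : ℝ × (Fin n → ℝ),
      (MeasurableEquiv.piFinSuccAbove (fun _ => ℝ) 0).symm z = (Fin.cons z.1 z.2 : _ → ℝ) := by
    intro z
    simp [MeasurableEquiv.piFinSuccAbove, Fin.insertNthEquiv]
  have hcm : ∀ i, Measurable fun z : ℝ × (Fin n → ℝ) => (Fin.cons z.1 z.2 : Fin (n + 1) → ℝ) i :=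
    fun i => by
      refine Fin.cases ?_ (fun i => ?_) i
      · simpa using measurable_fst
      · simp only [Fin.cons_succ]
        fun_prop
  have hmeas : Measurable fun z : ℝ × (Fin n → ℝ) => ENNReal.ofReal
      (√(fieldMatrix c η (Fin.cons z.1 z.2)).det *
        Real.exp (-fieldEnergy c η (Fin.cons z.1 z.2))) :=
    measurable_fieldDensity (c := fun _ => c) (η := fun _ => η) (fun _ _ => measurable_const)
      (fun _ => measurable_const) hcm
  rw [← hpres.lintegral_comp_emb (MeasurableEquiv.measurableEmbedding _)]
  simp_rw [hcons]
  rw [lintegral_prod_symm _ hmeas.aemeasurable]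
  have hmeas' : Measurable fun z : ℝ × (Fin n → ℝ) => ENNReal.ofReal
      (√(fieldMatrix (elimCond c z.1) (elimRoot c η z.1) z.2).det *
        Real.exp (-fieldEnergy (elimCond c z.1) (elimRoot c η z.1) z.2)) := by
    refine measurable_fieldDensity (c := fun z : ℝ × (Fin n → ℝ) => elimCond c z.1)
      (fun i j => ?_) (fun i => ?_) fun i => ?_
    · unfold elimCond; fun_prop
    · unfold elimRoot; fun_prop
    · fun_prop
  have hg : Measurable fun b : ℝ => ENNReal.ofReal (√b * Real.exp (-(b / 2) -
      localField c η 1 ^ 2 / (2 * b) + localField c η 1)) := by fun_prop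
  rw [lintegral_mul_lintegral_swap hg hmeas']
  refine lintegral_congr_ae ?_
  filter_upwards [ae_pi_mulHaar_pos] with r hr
  have hS := localField_pos hc hη hdet hr
  refine ((measurePreserving_mul_mulHaar (inv_pos.2 hS)).lintegral_comp
    (hmeas.comp (measurable_prodMk_right (y := r)))).symm.trans ?_
  refine lintegral_congr_ae ?_
  filter_upwards [ae_mulHaar_pos] with b hb
  simp only [Function.comp_apply]
  rw [← ENNReal.ofReal_mul (by positivity), fieldEnergy_cons hs hb hS,
    det_fieldMatrix_cons hs hb hS, Real.sqrt_mul hb.le, Real.exp_add]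
  congr 1
  ring

end Elimination

/-- The normalization of the hyperbolic sigma model mixing field. -/
theorem lintegral_fieldDensity_fin {n : ℕ} (c : Fin n → Fin n → ℝ) (η : Fin n → ℝ)
    (hs : ∀ i j, c i j = c j i) (hc : ∀ i j, 0 ≤ c i j) (hη : ∀ i, 0 ≤ η i)
    (hdet : ∀ r, (∀ i, 0 < r i) → 0 < (fieldMatrix c η r).det) :
    ∫⁻ r, ENNReal.ofReal (√(fieldMatrix c η r).det * Real.exp (-fieldEnergy c η r))
        ∂(Measure.pi fun _ => mulHaar) = ENNReal.ofReal (√(2 * π) ^ n) := by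
  induction n with
  | zero => simp [fieldEnergy]
  | succ n ih =>
    rw [lintegral_fieldDensity_succ hs hc hη hdet]
    have hq : 0 < localField c η 1 := localField_pos hc hη hdet fun _ => one_pos
    have hinner : ∀ᵐ b ∂mulHaar, ENNReal.ofReal (√b * Real.exp (-(b / 2) -
          localField c η 1 ^ 2 / (2 * b) + localField c η 1)) *
        ∫⁻ r, ENNReal.ofReal (√(fieldMatrix (elimCond c b) (elimRoot c η b) r).det *
          Real.exp (-fieldEnergy (elimCond c b) (elimRoot c η b) r))
          ∂(Measure.pi fun _ => mulHaar) =
        ENNReal.ofReal (√b * Real.exp (-(b / 2) -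
          localField c η 1 ^ 2 / (2 * b) + localField c η 1)) *
          ENNReal.ofReal (√(2 * π) ^ n) := by
      filter_upwards [ae_mulHaar_pos] with b hb
      rw [ih]
      · intro i j
        rw [elimCond, elimCond, hs, mul_comm (c 0 i.succ)]
      · exact fun i j => add_nonneg (hc _ _) (div_nonneg (mul_nonneg (hc _ _) (hc _ _)) hb.le)
      · exact fun i => add_nonneg (hη _) (div_nonneg (mul_nonneg (hc _ _) (hη _)) hb.le)
      · intro r hr
        have hS := localField_pos hc hη hdet hr
        have h := hdet (Fin.cons ((localField c η r)⁻¹ * b) r) fun i => by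
          refine Fin.cases ?_ (fun i => ?_) i
          · simpa using by positivity
          · simpa using hr i
        rw [det_fieldMatrix_cons hs hb hS] at h
        exact pos_of_mul_pos_right h hb.le
    rw [lintegral_congr_ae hinner, lintegral_mul_const _ (by fun_prop),
      lintegral_mulHaar_inverseGaussian hq, ← ENNReal.ofReal_mul (by positivity), pow_succ']

theorem lintegral_fieldDensity {ι : Type*} [Fintype ι] [DecidableEq ι] (c : ι → ι → ℝ)
    (η : ι → ℝ) (hs : ∀ i j, c i j = c j i) (hc : ∀ i j, 0 ≤ c i j) (hη : ∀ i, 0 ≤ η i)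
    (hdet : ∀ r, (∀ i, 0 < r i) → 0 < (fieldMatrix c η r).det) :
    ∫⁻ r, ENNReal.ofReal (√(fieldMatrix c η r).det * Real.exp (-fieldEnergy c η r))
        ∂(Measure.pi fun _ => mulHaar) = ENNReal.ofReal (√(2 * π) ^ Fintype.card ι) := by
  have e := (Fintype.equivFin ι).symm
  have hd : ∀ r : ι → ℝ, (fieldMatrix (fun i j => c (e i) (e j)) (fun i => η (e i))
      (fun i => r (e i))).det = (fieldMatrix c η r).det := fun r => by
    rw [← Matrix.det_submatrix_equiv_self e (fieldMatrix c η r)]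
    congr 1
    ext i j
    simp only [fieldMatrix, Matrix.sub_apply, Matrix.diagonal_apply, Matrix.of_apply,
      Matrix.submatrix_apply, e.injective.eq_iff, e.sum_comp (fun k => c (e i) k / r k)]
  have hE : ∀ r : ι → ℝ, fieldEnergy (fun i j => c (e i) (e j)) (fun i => η (e i))
      (fun i => r (e i)) = fieldEnergy c η r := fun r => by
    have h1 : ∀ i, ∑ j, c i (e j) * (r i / r (e j) - 1) = ∑ j, c i j * (r i / r j - 1) :=
      fun i => e.sum_comp fun j => c i j * (r i / r j - 1)
    simp only [fieldEnergy, e.sum_comp (fun i => η i * ((r i + 1 / r i) / 2 - 1)), h1,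
      e.sum_comp (fun i => ∑ j, c i j * (r i / r j - 1))]
  rw [← lintegral_fieldDensity_fin (fun i j => c (e i) (e j)) (fun i => η (e i))
    (fun _ _ => hs _ _) (fun _ _ => hc _ _) (fun _ => hη _), ← lintegral_pi_comp_equiv mulHaar e]
  · simp_rw [hd, hE]
  · intro r hr
    have := hdet (fun i => r (e.symm i)) fun i => hr _
    rw [← hd] at this
    simpa using this

section MatrixTree

/-- A parent map on the non-root vertices is grounded if it decreases some height function. -/
def Grounded {x : V} (f : {v // v ≠ x} → V) : Prop :=
  ∃ d : V → ℕ, ∀ i, d (f i) < d i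

/-- The rows of the reduced Laplacian of the functional graph of a parent map. -/
def parentMatrix {x : V} (f : {v // v ≠ x} → V) : Matrix {v // v ≠ x} {v // v ≠ x} ℝ :=
  fun i j => (if i = j then 1 else 0) - if f i = j then 1 else 0

theorem det_parentMatrix_of_grounded {x : V} {f : {v // v ≠ x} → V} (hf : Grounded f) :
    (parentMatrix f).det = 1 := by
  obtain ⟨d, hd⟩ := hf
  have hb : (parentMatrix f).BlockTriangular fun i => OrderDual.toDual (d i) := by
    intro i j hij
    have hij' : d i < d j := hij
    have h1 : i ≠ j := by rintro rfl; exact lt_irrefl _ hij'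
    have h2 : f i ≠ j := fun h => by have := hd i; rw [h] at this; omega
    simp [parentMatrix, h1, h2]
  rw [hb.det]
  refine Finset.prod_eq_one fun a _ => ?_
  rw [show (parentMatrix f).toSquareBlock (fun i => OrderDual.toDual (d i)) a = 1 from ?_,
    Matrix.det_one]
  ext i j
  have h2 : f i ≠ j := fun h => by
    have := hd i
    rw [h] at this
    have h3 : d i = d j := OrderDual.toDual.injective (i.2.trans j.2.symm)
    omega
  simp [parentMatrix, Matrix.toSquareBlock_def, h2, Matrix.one_apply, Subtype.ext_iff]

theorem det_parentMatrix_of_not_grounded {x : V} {f : {v // v ≠ x} → V} (hf : ¬ Grounded f) :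
    (parentMatrix f).det = 0 := by
  set p : V → V := fun v => if h : v ≠ x then f ⟨v, h⟩ else x with hp
  have hpi : ∀ i : {v // v ≠ x}, p i = f i := fun i => by simp [hp, i.2]
  have hx : ∃ v, ∀ n, p^[n] v ≠ x := by
    by_contra! h
    refine hf ⟨fun v => Nat.find (h v), fun i => ?_⟩
    have h1 := Nat.find_spec (h i)
    have h0 : Nat.find (h i) ≠ 0 := fun h0 => i.2 (by simpa [h0] using h1)
    obtain ⟨m, hm⟩ := Nat.exists_eq_succ_of_ne_zero h0
    rw [hm, Function.iterate_succ_apply, hpi] at h1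
    have h2 := Nat.find_min' (h (f i)) h1
    change Nat.find (h (f i)) < Nat.find (h i)
    omega
  obtain ⟨v, hv⟩ := hx
  rw [← Matrix.exists_mulVec_eq_zero_iff]
  refine ⟨fun i => if ∀ n, p^[n] i ≠ x then 1 else 0, fun h0 => ?_, ?_⟩
  · have := congrFun h0 ⟨v, hv 0⟩
    simp [hv] at this
  · ext i
    have key : (∀ n, p^[n] (i : V) ≠ x) ↔ ∀ n, p^[n] (f i) ≠ x := by
      rw [← hpi]
      refine ⟨fun h n => h (n + 1), fun h n => ?_⟩
      cases n with
      | zero => exact i.2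
      | succ n => exact h n
    simp only [Matrix.mulVec, dotProduct, parentMatrix, sub_mul, Finset.sum_sub_distrib, ite_mul,
      one_mul, zero_mul, Finset.sum_ite_eq, Finset.mem_univ, if_true, Pi.zero_apply, key]
    by_cases hfx : f i = x
    · have : ¬ ∀ n, p^[n] (f i) ≠ x := fun h => h 0 hfx
      rw [if_neg this, zero_sub, neg_eq_zero]
      refine Finset.sum_eq_zero fun j _ => ?_
      rw [if_neg]
      exact fun h => j.2 (h ▸ hfx)
    · rw [Finset.sum_eq_single ⟨f i, hfx⟩]
      · simp
      · intro j _ hj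
        rw [if_neg]
        exact fun h => hj (Subtype.ext h.symm)
      · simp

/-- The Laplacian with the row and column of `x` removed. -/
def reducedLaplacian (x : V) (W : V → V → ℝ) : Matrix {v // v ≠ x} {v // v ≠ x} ℝ :=
  fun i j => (if i = j then ∑ k, W i k else 0) - W i j

theorem det_reducedLaplacian (x : V) (W : V → V → ℝ) :
    (reducedLaplacian x W).det =
      ∑ f : {v // v ≠ x} → V with Grounded f,
        ∏ i : {v // v ≠ x}, W i (f i) := by
  have hrow : reducedLaplacian x W = fun i : {v // v ≠ x} => ∑ k, W i k •
      fun j : {v // v ≠ x} =>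
      ((if i = j then 1 else 0) - if k = j then 1 else 0 : ℝ) := by
    ext i j
    simp only [reducedLaplacian, Finset.sum_apply, Pi.smul_apply, smul_eq_mul, mul_sub,
      Finset.sum_sub_distrib, mul_ite, mul_one, mul_zero, Finset.sum_ite_eq', Finset.mem_univ,
      if_true]
    congr 1
    split_ifs <;> simp
  rw [hrow]
  have h1 := (Matrix.detRowAlternating (R := ℝ) (n := {v // v ≠ x})).toMultilinearMap.map_sum
    fun (i : {v // v ≠ x}) (k : V) => W i k • fun j : {v // v ≠ x} =>
      ((if i = j then 1 else 0) - if k = j then 1 else 0 : ℝ)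
  refine h1.trans ?_
  rw [Finset.sum_filter]
  refine Finset.sum_congr rfl fun f _ => ?_
  rw [MultilinearMap.map_smul_univ, smul_eq_mul]
  change _ * (parentMatrix f).det = _
  split_ifs with hf
  · rw [det_parentMatrix_of_grounded hf, mul_one]
  · rw [det_parentMatrix_of_not_grounded hf, mul_zero]

/-- The edge set of the functional graph of a parent map. -/
def parentEdges {x : V} (f : {v // v ≠ x} → V) : Finset (Sym2 V) :=
  Finset.univ.image fun i : {v // v ≠ x} => s((i : V), f i)

omit [Fintype V] in
theorem Grounded.edge_injective {x : V} {f : {v // v ≠ x} → V} (hf : Grounded f) :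
    Function.Injective fun i : {v // v ≠ x} => s((i : V), f i) := by
  obtain ⟨d, hd⟩ := hf
  intro i j hij
  rcases Sym2.eq_iff.1 hij with h | h
  · exact Subtype.ext h.1
  · have h1 := hd i
    have h2 := hd j
    rw [h.2] at h1
    rw [← h.1] at h2
    omega

theorem Grounded.card_parentEdges {x : V} {f : {v // v ≠ x} → V} (hf : Grounded f) :
    (parentEdges f).card + 1 = Fintype.card V := by
  rw [parentEdges, Finset.card_image_of_injective _ hf.edge_injective, Finset.card_univ,
    Fintype.card_subtype_compl, Fintype.card_subtype_eq]
  have := Fintype.card_pos_iff.2 ⟨x⟩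
  omega

theorem Grounded.isTree {x : V} {f : {v // v ≠ x} → V} (hf : Grounded f) :
    (SimpleGraph.fromEdgeSet (parentEdges f : Set (Sym2 V))).IsTree := by
  have hne : ∀ i : {v // v ≠ x}, (i : V) ≠ f i := fun i h => by
    obtain ⟨d, hd⟩ := hf
    have := hd i
    rw [← h] at this
    exact lt_irrefl _ this
  rw [SimpleGraph.isTree_iff_connected_and_card]
  constructor
  · have hr : ∀ v, (SimpleGraph.fromEdgeSet (parentEdges f : Set (Sym2 V))).Reachable v x := by
      obtain ⟨d, hd⟩ := hf
      intro v
      induction hk : d v using Nat.strong_induction_on generalizing v with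
      | _ k ih =>
        by_cases hv : v = x
        · rw [hv]
        · have hadj : (SimpleGraph.fromEdgeSet (parentEdges f : Set (Sym2 V))).Adj v
              (f ⟨v, hv⟩) := by
            rw [SimpleGraph.fromEdgeSet_adj]
            exact ⟨Finset.mem_coe.2 (Finset.mem_image.2 ⟨⟨v, hv⟩, Finset.mem_univ _, rfl⟩),
              hne ⟨v, hv⟩⟩
          exact hadj.reachable.trans (ih _ (hk ▸ hd ⟨v, hv⟩) _ rfl)
    have : Nonempty V := ⟨x⟩
    exact ⟨fun u v => (hr u).trans (hr v).symm⟩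
  · have hE : (SimpleGraph.fromEdgeSet (parentEdges f : Set (Sym2 V))).edgeSet =
        (parentEdges f : Set (Sym2 V)) := by
      rw [SimpleGraph.edgeSet_fromEdgeSet, sdiff_eq_left, Set.disjoint_left]
      rintro e he hdiag
      obtain ⟨i, -, rfl⟩ := Finset.mem_image.1 (Finset.mem_coe.1 he)
      exact hne i (by simpa using hdiag)
    rw [hE, Nat.card_coe_set_eq, Set.ncard_coe_finset, Nat.card_eq_fintype_card,
      hf.card_parentEdges]

theorem parentEdges_injOn {x : V} {f g : {v // v ≠ x} → V} (hf : Grounded f)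
    (h : parentEdges f = parentEdges g) : f = g := by
  obtain ⟨d, hd⟩ := hf
  have key : ∀ i, f i = g i := by
    intro i
    induction hk : d i using Nat.strong_induction_on generalizing i with
    | _ k ih =>
      have hi : s((i : V), f i) ∈ parentEdges g :=
        h ▸ Finset.mem_image_of_mem _ (Finset.mem_univ i)
      obtain ⟨j, -, hj⟩ := Finset.mem_image.1 hi
      rcases Sym2.eq_iff.1 hj with ⟨h1, h2⟩ | ⟨h1, h2⟩
      · rw [← h2, Subtype.ext h1]
      · have hji : d j < d i := h1 ▸ hd i
        have h3 := hd j
        rw [ih _ (hk ▸ hji) j rfl, h2] at h3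
        omega
  exact funext key

theorem exists_parentEdges_eq {x : V} {F : Finset (Sym2 V)}
    (hF : (SimpleGraph.fromEdgeSet (F : Set (Sym2 V))).IsTree) (hdiag : ∀ e ∈ F, ¬ e.IsDiag) :
    ∃ f : {v // v ≠ x} → V, Grounded f ∧ parentEdges f = F := by
  set H := SimpleGraph.fromEdgeSet (F : Set (Sym2 V)) with hH
  have hstep : ∀ i : {v // v ≠ x}, ∃ k, H.Adj i k ∧ H.dist k x < H.dist i x := by
    intro i
    obtain ⟨p, hp⟩ := hF.connected.exists_walk_length_eq_dist i x
    have hnil : ¬ p.Nil := SimpleGraph.Walk.not_nil_of_ne i.2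
    refine ⟨p.snd, p.adj_snd hnil, ?_⟩
    have := SimpleGraph.dist_le p.tail
    have := SimpleGraph.Walk.length_tail_add_one hnil
    omega
  choose f hadj hlt using hstep
  have hf : Grounded f := ⟨fun v => H.dist v x, hlt⟩
  have hE : H.edgeSet = (F : Set (Sym2 V)) := by
    rw [hH, SimpleGraph.edgeSet_fromEdgeSet, sdiff_eq_left, Set.disjoint_left]
    exact fun e he hd => hdiag e (by simpa using he) (by simpa using hd)
  refine ⟨f, hf, Finset.eq_of_subset_of_card_le ?_ ?_⟩
  · intro e he
    obtain ⟨i, -, rfl⟩ := Finset.mem_image.1 he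
    have : s((i : V), f i) ∈ H.edgeSet := hadj i
    rwa [hE, Finset.mem_coe] at this
  · have h1 := (SimpleGraph.isTree_iff_connected_and_card.1 hF).2
    rw [hE, Nat.card_coe_set_eq, Set.ncard_coe_finset, Nat.card_eq_fintype_card] at h1
    have h2 := hf.card_parentEdges
    omega

/-- Kirchhoff's matrix-tree theorem. -/
theorem det_reducedLaplacian_eq_tau (G : SimpleGraph V) [DecidableRel G.Adj] (x : V)
    (w : Sym2 V → ℝ) :
    (reducedLaplacian x fun i j => if G.Adj i j then w s(i, j) else 0).det = tau G w := by
  have hdiag : ∀ e ∈ G.edgeFinset, ¬ e.IsDiag := fun e he =>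
    G.not_isDiag_of_mem_edgeSet (SimpleGraph.mem_edgeFinset.1 he)
  have hsub : ∑ f : {v // v ≠ x} → V with (Grounded f ∧ ∀ i : {v // v ≠ x}, G.Adj i (f i)),
      ∏ i : {v // v ≠ x}, (if G.Adj i (f i) then w s((i : V), f i) else 0) =
      ∑ f : {v // v ≠ x} → V with Grounded f,
        ∏ i : {v // v ≠ x}, if G.Adj i (f i) then w s((i : V), f i) else 0 := by
    refine Finset.sum_subset (fun f hf => ?_) fun f hf hf' => ?_
    · simp only [Finset.mem_filter] at hf ⊢
      exact ⟨hf.1, hf.2.1⟩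
    · simp only [Finset.mem_filter, Finset.mem_univ, true_and, not_and, not_forall] at hf hf'
      obtain ⟨i, hi⟩ := hf' hf
      exact Finset.prod_eq_zero (Finset.mem_univ i) (if_neg hi)
  rw [det_reducedLaplacian, ← hsub, tau]
  refine Finset.sum_bij (fun f _ => parentEdges f) (fun f hf => ?_) (fun f hf g hg h => ?_)
    (fun F hF => ?_) fun f hf => ?_
  · simp only [Finset.mem_filter, Finset.mem_univ, true_and] at hf
    rw [spanningTrees, Finset.mem_filter, Finset.mem_powerset]
    refine ⟨fun e he => ?_, hf.1.isTree⟩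
    obtain ⟨i, -, rfl⟩ := Finset.mem_image.1 he
    simpa using hf.2 i
  · simp only [Finset.mem_filter, Finset.mem_univ, true_and] at hf
    exact parentEdges_injOn hf.1 h
  · rw [spanningTrees, Finset.mem_filter, Finset.mem_powerset] at hF
    obtain ⟨f, hf, rfl⟩ := exists_parentEdges_eq (x := x) hF.2 fun e he => hdiag e (hF.1 he)
    refine ⟨f, ?_, rfl⟩
    simp only [Finset.mem_filter, Finset.mem_univ, true_and]
    refine ⟨hf, fun i => ?_⟩
    have := hF.1 (Finset.mem_image_of_mem (fun i : {v // v ≠ x} => s((i : V), f i))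
      (Finset.mem_univ i))
    simpa using this
  · simp only [Finset.mem_filter, Finset.mem_univ, true_and] at hf
    rw [parentEdges, Finset.prod_image fun i _ j _ h => hf.1.edge_injective h]
    exact Finset.prod_congr rfl fun i _ => if_pos (hf.2 i)

omit [DecidableEq V] in
theorem tau_pos {G : SimpleGraph V} [DecidableRel G.Adj] (hG : G.Connected) {w : Sym2 V → ℝ}
    (hw : ∀ e ∈ G.edgeFinset, 0 < w e) : 0 < tau G w := by
  refine Finset.sum_pos (fun F hF => Finset.prod_pos fun e he => hw e ?_) ?_
  · rw [spanningTrees, Finset.mem_filter, Finset.mem_powerset] at hF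
    exact hF.1 he
  · obtain ⟨H, hH, hT⟩ := hG.exists_isTree_le
    refine ⟨H.edgeFinset, ?_⟩
    rw [spanningTrees, Finset.mem_filter, Finset.mem_powerset]
    refine ⟨SimpleGraph.edgeFinset_mono hH, ?_⟩
    rwa [SimpleGraph.coe_edgeFinset, SimpleGraph.fromEdgeSet_edgeSet]

omit [DecidableEq V] in
theorem tau_const_mul (G : SimpleGraph V) [DecidableRel G.Adj] (t : ℝ) (w : Sym2 V → ℝ) :
    tau G (fun e => t * w e) = t ^ (Fintype.card V - 1) * tau G w := by
  rw [tau, tau, Finset.mul_sum]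
  refine Finset.sum_congr rfl fun F hF => ?_
  rw [spanningTrees, Finset.mem_filter, Finset.mem_powerset] at hF
  obtain ⟨hFG, hF⟩ := hF
  have hE : (SimpleGraph.fromEdgeSet (F : Set (Sym2 V))).edgeSet = (F : Set (Sym2 V)) := by
    rw [SimpleGraph.edgeSet_fromEdgeSet, sdiff_eq_left, Set.disjoint_left]
    exact fun e he hd => G.not_isDiag_of_mem_edgeSet
      (SimpleGraph.mem_edgeFinset.1 (hFG (Finset.mem_coe.1 he))) (by simpa using hd)
  have h1 := (SimpleGraph.isTree_iff_connected_and_card.1 hF).2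
  rw [hE, Nat.card_coe_set_eq, Set.ncard_coe_finset, Nat.card_eq_fintype_card] at h1
  rw [Finset.prod_mul_distrib, Finset.prod_const, ← h1, Nat.add_sub_cancel]

end MatrixTree

/-- Symmetrization of a function of two vertices, as a function of unordered pairs. -/
@[to_additive]
def symProd {M : Type*} [CommMonoid M] (g : V → V → M) : Sym2 V → M :=
  Sym2.lift ⟨fun i j => g i j * g j i, fun _ _ => mul_comm _ _⟩

@[to_additive]
theorem prod_prod_neighborFinset {M : Type*} [CommMonoid M] (G : SimpleGraph V)
    [DecidableRel G.Adj] (g : V → V → M) :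
    ∏ i, ∏ j ∈ G.neighborFinset i, g i j = ∏ e ∈ G.edgeFinset, symProd g e := by
  have h1 : ∏ i, ∏ j ∈ G.neighborFinset i, g i j = ∏ d : G.Dart, g d.fst d.snd := by
    rw [Finset.prod_sigma']
    refine Finset.prod_bij' (fun p hp => ⟨(p.1, p.2), by simpa using hp⟩)
      (fun d _ => ⟨d.fst, d.snd⟩) ?_ ?_ ?_ ?_ ?_
    · simp
    · simp
    · simp
    · simp
    · simp
  rw [h1, ← Finset.prod_fiberwise_of_maps_to (g := fun d : G.Dart => d.edge) (t := G.edgeFinset)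
    fun d _ => SimpleGraph.mem_edgeFinset.2 d.edge_mem]
  refine Finset.prod_congr rfl fun e he => ?_
  induction e with | _ a b =>
  have hab : G.Adj a b := by simpa using he
  have := SimpleGraph.Dart.edge_fiber (⟨(a, b), hab⟩ : G.Dart)
  have h2 : (Finset.univ.filter fun d : G.Dart => d.edge = s(a, b)) =
      {⟨(a, b), hab⟩, SimpleGraph.Dart.symm ⟨(a, b), hab⟩} := by
    rw [← this]; rfl
  rw [h2, Finset.prod_pair (SimpleGraph.Dart.symm_ne _).symm]
  rfl

theorem sum_vw (G : SimpleGraph V) [DecidableRel G.Adj] (B : Sym2 V → ℝ) :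
    ∑ v, vw G B v = 2 * ∑ e ∈ G.edgeFinset, B e := by
  simp only [vw]
  rw [sum_sum_neighborFinset, Finset.mul_sum]
  refine Finset.sum_congr rfl fun e _ => ?_
  induction e with | _ a b =>
  simp only [symSum, Sym2.lift_mk, Sym2.eq_swap (a := b) (b := a)]
  ring

theorem prod_sprod_rpow (G : SimpleGraph V) [DecidableRel G.Adj] (B : Sym2 V → ℝ) {r : V → ℝ}
    (hr : ∀ v, 0 < r v) :
    ∏ e ∈ G.edgeFinset, sprod r e ^ B e = ∏ v, r v ^ vw G B v := by
  simp only [vw]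
  simp_rw [Real.rpow_sum_of_pos (hr _)]
  rw [prod_prod_neighborFinset]
  refine Finset.prod_congr rfl fun e _ => ?_
  induction e with | _ a b =>
  simp only [symProd, sprod, Sym2.lift_mk, Sym2.eq_swap (a := b) (b := a)]
  rw [Real.mul_rpow (hr a).le (hr b).le]

/-- The edge function `r_i / r_j + r_j / r_i`. -/
def ratioSum (r : V → ℝ) : Sym2 V → ℝ := symSum fun i j => r i / r j

theorem sum_sprod_mul_ratioSum (G : SimpleGraph V) [DecidableRel G.Adj] (w : Sym2 V → ℝ)
    {r : V → ℝ} (hr : ∀ v, 0 < r v) :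
    ∑ e ∈ G.edgeFinset, sprod r e * w e * ratioSum r e = ∑ v, r v ^ 2 * vw G w v := by
  simp only [vw, Finset.mul_sum]
  rw [sum_sum_neighborFinset]
  refine Finset.sum_congr rfl fun e _ => ?_
  induction e with | _ a b =>
  have := (hr a).ne'
  have := (hr b).ne'
  simp only [symSum, ratioSum, sprod, Sym2.lift_mk, Sym2.eq_swap (a := b) (b := a)]
  field_simp

/-- Extension of a function on the non-root vertices by `1` at the root. -/
def rootExt (x : V) (r : {v // v ≠ x} → ℝ) (v : V) : ℝ :=
  if h : v ≠ x then r ⟨v, h⟩ else 1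

omit [Fintype V] in
theorem rootExt_pos {x : V} {r : {v // v ≠ x} → ℝ} (hr : ∀ i, 0 < r i) (v : V) :
    0 < rootExt x r v := by
  unfold rootExt
  split_ifs with h
  exacts [hr _, one_pos]

omit [Fintype V] in
@[simp] theorem rootExt_coe {x : V} (r : {v // v ≠ x} → ℝ) (i : {v // v ≠ x}) :
    rootExt x r i = r i := by
  simp [rootExt, i.2]

omit [Fintype V] in
@[simp] theorem rootExt_root {x : V} (r : {v // v ≠ x} → ℝ) : rootExt x r x = 1 := by
  simp [rootExt]

@[to_additive]
theorem prod_eq_mul_prod_ne {M : Type*} [CommMonoid M] (x : V) (f : V → M) :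
    ∏ v, f v = f x * ∏ i : {v // v ≠ x}, f i := by
  rw [← Finset.mul_prod_erase _ _ (Finset.mem_univ x)]
  congr 1
  exact Finset.prod_subtype _ (by simp) _

/-- The matrix of conductances. -/
def adjWeight (G : SimpleGraph V) [DecidableRel G.Adj] (w : Sym2 V → ℝ) (i j : V) : ℝ :=
  if G.Adj i j then w s(i, j) else 0

omit [Fintype V] [DecidableEq V] in
theorem adjWeight_comm (G : SimpleGraph V) [DecidableRel G.Adj] (w : Sym2 V → ℝ) (i j : V) :
    adjWeight G w i j = adjWeight G w j i := by
  simp only [adjWeight, G.adj_comm i j, Sym2.eq_swap (a := i) (b := j)]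

omit [DecidableEq V] in
theorem adjWeight_nonneg {G : SimpleGraph V} [DecidableRel G.Adj] {w : Sym2 V → ℝ}
    (hw : ∀ e ∈ G.edgeFinset, 0 < w e) (i j : V) : 0 ≤ adjWeight G w i j := by
  unfold adjWeight
  split_ifs with h
  exacts [(hw _ (by simpa using h)).le, le_rfl]

theorem det_fieldMatrix_adjWeight (G : SimpleGraph V) [DecidableRel G.Adj] (x : V)
    (w : Sym2 V → ℝ) {r : {v // v ≠ x} → ℝ} (hr : ∀ i, 0 < r i) :
    (fieldMatrix (fun i j : {v // v ≠ x} => 2 * adjWeight G w i j)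
      (fun i => 2 * adjWeight G w i x) r).det =
    2 ^ (Fintype.card V - 1) * (∏ i, r i) ^ 2 *
      tau G fun e => w e / sprod (rootExt x r) e := by
  have h1 : fieldMatrix (fun i j : {v // v ≠ x} => 2 * adjWeight G w i j)
      (fun i => 2 * adjWeight G w i x) r = (2 : ℝ) • Matrix.of fun i j => r i *
        (Matrix.of fun i j => r j * reducedLaplacian x (fun i j => if G.Adj i j then
          w s(i, j) / sprod (rootExt x r) s(i, j) else 0) i j : Matrix _ _ ℝ) i j := by
    ext i j
    have hi := (hr i).ne'
    have hj := (hr j).ne'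
    simp only [fieldMatrix, Matrix.sub_apply, Matrix.diagonal_apply, Matrix.of_apply,
      Matrix.smul_apply, smul_eq_mul, reducedLaplacian, sprod, Sym2.lift_mk, rootExt_coe]
    rw [sum_eq_add_sum_ne x]
    simp only [rootExt_root, rootExt_coe, adjWeight]
    have hsum : ∀ i : {v // v ≠ x}, r i * ∑ k : {v // v ≠ x},
        (if G.Adj i k then w s((i : V), k) / (r i * r k) else 0) =
        ∑ k : {v // v ≠ x}, (if G.Adj i k then w s((i : V), k) else 0) / r k := by
      intro i
      rw [Finset.mul_sum]
      refine Finset.sum_congr rfl fun k _ => ?_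
      have := (hr i).ne'
      have := (hr k).ne'
      split_ifs
      · field_simp
      · simp
    have hA : (if G.Adj (i : V) j then w s((i : V), j) / (r i * r j) else 0) =
      (if G.Adj (i : V) j then w s((i : V), j) else 0) / (r i * r j) := by
      split_ifs <;> simp
    have hB : (if G.Adj (i : V) x then w s((i : V), x) / (r i * 1) else 0) =
      (if G.Adj (i : V) x then w s((i : V), x) else 0) / r i := by
      split_ifs <;> simp
    rw [hA, hB]
    simp_rw [mul_div_assoc, ← Finset.mul_sum]
    by_cases hij : i = j
    · subst hij
      rw [if_pos rfl, if_pos rfl, ← hsum]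
      field_simp
      ring
    · rw [if_neg hij, if_neg hij]
      field_simp
      ring
  rw [h1, Matrix.det_smul, Matrix.det_mul_column, Matrix.det_mul_row,
    det_reducedLaplacian_eq_tau G x fun e => w e / sprod (rootExt x r) e,
    Fintype.card_subtype_compl, Fintype.card_subtype_eq]
  ring

theorem fieldEnergy_adjWeight (G : SimpleGraph V) [DecidableRel G.Adj] (x : V)
    (w : Sym2 V → ℝ) (r : {v // v ≠ x} → ℝ) :
    fieldEnergy (fun i j : {v // v ≠ x} => 2 * adjWeight G w i j)
      (fun i => 2 * adjWeight G w i x) r =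
    ∑ e ∈ G.edgeFinset, w e * ratioSum (rootExt x r) e - 2 * ∑ e ∈ G.edgeFinset, w e := by
  set R := rootExt x r with hR
  have h1 : ∑ e ∈ G.edgeFinset, w e * ratioSum R e - 2 * ∑ e ∈ G.edgeFinset, w e =
      ∑ i, ∑ j, adjWeight G w i j * (R i / R j - 1) := by
    rw [Finset.mul_sum, ← Finset.sum_sub_distrib]
    have h2 : ∀ i, ∑ j, adjWeight G w i j * (R i / R j - 1) =
        ∑ j ∈ G.neighborFinset i, w s(i, j) * (R i / R j - 1) := fun i => by
      simp only [adjWeight, ite_mul, zero_mul, SimpleGraph.neighborFinset_eq_filter,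
        Finset.sum_filter]
    simp_rw [h2]
    rw [sum_sum_neighborFinset]
    refine Finset.sum_congr rfl fun e _ => ?_
    induction e with | _ a b =>
    simp only [symSum, ratioSum, Sym2.lift_mk, Sym2.eq_swap (a := b) (b := a)]
    ring
  rw [h1, sum_eq_add_sum_ne x, sum_eq_add_sum_ne x]
  simp_rw [sum_eq_add_sum_ne x (fun j => adjWeight G w _ j * _)]
  simp only [hR, rootExt_root, rootExt_coe, div_one, sub_self, mul_zero, zero_add,
    adjWeight_comm G w x, fieldEnergy, Finset.sum_add_distrib]
  rw [← add_assoc, ← Finset.sum_add_distrib, add_comm, Finset.sum_div]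
  congr 1
  · exact Finset.sum_congr rfl fun i _ => by ring
  · refine Finset.sum_congr rfl fun i _ => ?_
    rw [Finset.sum_div]
    exact Finset.sum_congr rfl fun j _ => by ring

theorem lintegral_sqrt_tau_mul_exp {G : SimpleGraph V} [DecidableRel G.Adj] (hG : G.Connected)
    (x : V) {w : Sym2 V → ℝ} (hw : ∀ e ∈ G.edgeFinset, 0 < w e) :
    ∫⁻ r : {v // v ≠ x} → ℝ, ENNReal.ofReal ((∏ i, r i) *
        √(tau G fun e => w e / sprod (rootExt x r) e) *
        Real.exp (-∑ e ∈ G.edgeFinset, w e * ratioSum (rootExt x r) e))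
      ∂(Measure.pi fun _ => mulHaar) =
    ENNReal.ofReal (√π ^ (Fintype.card V - 1) *
      Real.exp (-(2 * ∑ e ∈ G.edgeFinset, w e))) := by
  have hsp : ∀ r : {v // v ≠ x} → ℝ, (∀ i, 0 < r i) →
      0 < tau G fun e => w e / sprod (rootExt x r) e := fun r hr => by
    refine tau_pos hG fun e he => div_pos (hw e he) ?_
    induction e with | _ a b =>
    exact mul_pos (rootExt_pos hr a) (rootExt_pos hr b)
  have h := lintegral_fieldDensity (fun i j : {v // v ≠ x} => 2 * adjWeight G w i j)
    (fun i => 2 * adjWeight G w i x) (fun i j => by rw [adjWeight_comm])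
    (fun i j => mul_nonneg two_pos.le (adjWeight_nonneg hw _ _))
    (fun i => mul_nonneg two_pos.le (adjWeight_nonneg hw _ _)) fun r hr => by
      rw [det_fieldMatrix_adjWeight G x w hr]
      have := Finset.prod_pos fun i (_ : i ∈ Finset.univ) => hr i
      have := hsp r hr
      positivity
  have h2 : ∫⁻ r : {v // v ≠ x} → ℝ, ENNReal.ofReal ((∏ i, r i) *
        √(tau G fun e => w e / sprod (rootExt x r) e) *
        Real.exp (-∑ e ∈ G.edgeFinset, w e * ratioSum (rootExt x r) e))
      ∂(Measure.pi fun _ => mulHaar) = ENNReal.ofReal ((√2 ^ (Fintype.card V - 1))⁻¹ *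
      Real.exp (-(2 * ∑ e ∈ G.edgeFinset, w e))) * ENNReal.ofReal (√(2 * π) ^
        Fintype.card {v // v ≠ x}) := by
    rw [← h, ← lintegral_const_mul' _ _ ENNReal.ofReal_ne_top]
    refine lintegral_congr_ae ?_
    filter_upwards [ae_pi_mulHaar_pos] with r hr
    have hp := Finset.prod_pos fun i (_ : i ∈ Finset.univ) => hr i
    have ht := hsp r hr
    rw [det_fieldMatrix_adjWeight G x w hr, fieldEnergy_adjWeight G x w r,
      ← ENNReal.ofReal_mul (by positivity), Real.sqrt_mul (by positivity),
      Real.sqrt_mul (by positivity), Real.sqrt_sq hp.le, Real.sqrt_eq_rpow (2 ^ _),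
      ← Real.rpow_natCast_mul (by positivity), mul_comm (_ : ℝ) (1 / 2 : ℝ),
      Real.rpow_mul_natCast (by positivity), ← Real.sqrt_eq_rpow, neg_sub, Real.exp_sub,
      Real.exp_neg, Real.exp_neg]
    congr 1
    field_simp
  rw [h2, ← ENNReal.ofReal_mul (by positivity), Real.sqrt_mul (by positivity), mul_pow,
    Fintype.card_subtype_compl, Fintype.card_subtype_eq]
  congr 1
  field_simp

section Measurability

variable {α : Type*} [MeasurableSpace α]

omit [DecidableEq V] in
theorem measurable_vw (G : SimpleGraph V) [DecidableRel G.Adj] {w : α → Sym2 V → ℝ}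
    (hw : ∀ e, Measurable fun a => w a e) (v : V) : Measurable fun a => vw G (w a) v :=
  Finset.measurable_sum _ fun _ _ => hw _

omit [DecidableEq V] in
theorem measurable_tau (G : SimpleGraph V) [DecidableRel G.Adj] {w : α → Sym2 V → ℝ}
    (hw : ∀ e, Measurable fun a => w a e) : Measurable fun a => tau G (w a) :=
  Finset.measurable_sum _ fun _ _ => Finset.measurable_prod _ fun _ _ => hw _

omit [Fintype V] [DecidableEq V] in
theorem measurable_sprod {r : α → V → ℝ} (hr : ∀ v, Measurable fun a => r a v) (e : Sym2 V) :
    Measurable fun a => sprod (r a) e := by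
  induction e with | _ i j =>
  exact (hr i).mul (hr j)

omit [Fintype V] [DecidableEq V] in
theorem measurable_ratioSum {r : α → V → ℝ} (hr : ∀ v, Measurable fun a => r a v)
    (e : Sym2 V) : Measurable fun a => ratioSum (r a) e := by
  induction e with | _ i j =>
  exact ((hr i).div (hr j)).add ((hr j).div (hr i))

omit [Fintype V] in
theorem measurable_rootExt (x v : V) : Measurable fun r => rootExt x r v := by
  unfold rootExt
  split_ifs
  exacts [measurable_pi_apply _, measurable_const]

end Measurability

omit [Fintype V] [DecidableEq V] in
theorem sprod_pos {r : V → ℝ} (hr : ∀ v, 0 < r v) (e : Sym2 V) : 0 < sprod r e := by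
  induction e with | _ i j =>
  exact mul_pos (hr i) (hr j)

section PinnedCoordinates

variable (G : SimpleGraph V) [DecidableRel G.Adj] (e0 : Sym2 V)

/-- The environment with weight `p.1` at `e0` and weights `p.2` at the other edges. -/
def coordExt (p : ℝ × (Epin G e0 → ℝ)) : Sym2 V → ℝ :=
  fun e => if e = e0 then p.1 else if h : e ∈ G.edgeFinset ∧ e ≠ e0 then p.2 ⟨e, h⟩ else 0

/-- The multiplicative Haar measure on environments. -/
def coordHaar : Measure (ℝ × (Epin G e0 → ℝ)) := mulHaar.prod (Measure.pi fun _ => mulHaar)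

instance : SFinite (coordHaar G e0) := inferInstanceAs (SFinite (Measure.prod _ _))

variable {G e0}

theorem measurable_coordExt (e : Sym2 V) : Measurable fun p => coordExt G e0 p e := by
  unfold coordExt
  split_ifs
  exacts [measurable_fst, (measurable_pi_apply _).comp measurable_snd, measurable_const]

@[simp] theorem coordExt_self (p : ℝ × (Epin G e0 → ℝ)) : coordExt G e0 p e0 = p.1 :=
  if_pos rfl

@[simp] theorem coordExt_coe (p : ℝ × (Epin G e0 → ℝ)) (e : Epin G e0) :
    coordExt G e0 p e = p.2 e := by
  simp only [coordExt, if_neg e.2.2, dif_pos e.2]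

theorem coordExt_pos {p : ℝ × (Epin G e0 → ℝ)} (h1 : 0 < p.1) (h2 : ∀ e, 0 < p.2 e) :
    ∀ e ∈ G.edgeFinset, 0 < coordExt G e0 p e := by
  intro e he
  by_cases h : e = e0
  · subst h
    simpa using h1
  · simpa using (coordExt_coe p ⟨e, he, h⟩).symm ▸ h2 ⟨e, he, h⟩

theorem coordExt_mul (s : Sym2 V → ℝ) (p : ℝ × (Epin G e0 → ℝ)) :
    coordExt G e0 (s e0 * p.1, fun e : Epin G e0 => s e * p.2 e) =
      fun e => s e * coordExt G e0 p e := by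
  ext e
  unfold coordExt
  split_ifs with h h
  · rw [h]
  · rfl
  · rw [mul_zero]

theorem prod_edgeFinset {M : Type*} [CommMonoid M] (he0 : e0 ∈ G.edgeFinset)
    (f : Sym2 V → M) : ∏ e ∈ G.edgeFinset, f e = f e0 * ∏ e : Epin G e0, f e := by
  rw [← Finset.mul_prod_erase _ _ he0]
  congr 1
  exact Finset.prod_subtype _ (fun e => by rw [Finset.mem_erase, and_comm]) _

theorem ae_coordHaar_pos :
    ∀ᵐ p ∂coordHaar G e0, 0 < p.1 ∧ ∀ e, 0 < p.2 e := by
  refine (Measure.quasiMeasurePreserving_fst.ae ae_mulHaar_pos).and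
    (Measure.quasiMeasurePreserving_snd.ae ae_pi_mulHaar_pos)

theorem measurePreserving_mul_coordHaar {s : Sym2 V → ℝ} (hs : ∀ e, 0 < s e) :
    MeasurePreserving
      (fun p : ℝ × (Epin G e0 → ℝ) => (s e0 * p.1, fun e : Epin G e0 => s e * p.2 e))
      (coordHaar G e0) (coordHaar G e0) :=
  (measurePreserving_mul_mulHaar (hs e0)).prod
    (measurePreserving_mul_pi_mulHaar fun e : Epin G e0 => hs e)

theorem lintegral_prod_coordExt (he0 : e0 ∈ G.edgeFinset) {f : Sym2 V → ℝ → ℝ≥0∞}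
    (hf : ∀ e, Measurable (f e)) :
    ∫⁻ p, ∏ e ∈ G.edgeFinset, f e (coordExt G e0 p e) ∂coordHaar G e0 =
      ∏ e ∈ G.edgeFinset, ∫⁻ t, f e t ∂mulHaar := by
  simp_rw [prod_edgeFinset he0, coordExt_self, coordExt_coe]
  have hm : Measurable fun u : Epin G e0 → ℝ => ∏ e : Epin G e0, f e (u e) :=
    Finset.measurable_prod _ fun e _ => (hf _).comp (measurable_pi_apply e)
  rw [coordHaar, lintegral_prod_mul (hf e0).aemeasurable hm.aemeasurable,
    lintegral_pi_finset_prod mulHaar (fun e : Epin G e0 => f e) fun e => hf e]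

end PinnedCoordinates

section MagicFormula

variable {G : SimpleGraph V} [DecidableRel G.Adj] {e0 : Sym2 V}

/-- The joint density of environments and mixing fields. -/
def jointDensity (G : SimpleGraph V) [DecidableRel G.Adj] (x : V) (B w : Sym2 V → ℝ)
    (r : {v // v ≠ x} → ℝ) : ℝ :=
  (∏ e ∈ G.edgeFinset, w e ^ B e) * ((∏ i, r i) *
    √(tau G fun e => w e / sprod (rootExt x r) e) *
    Real.exp (-∑ e ∈ G.edgeFinset, w e * ratioSum (rootExt x r) e))

theorem measurable_jointDensity {α : Type*} [MeasurableSpace α] (x : V) (B : Sym2 V → ℝ)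
    {w : α → Sym2 V → ℝ} {r : α → {v // v ≠ x} → ℝ} (hw : ∀ e, Measurable fun a => w a e)
    (hr : Measurable r) : Measurable fun a => jointDensity G x B (w a) (r a) := by
  have hR : ∀ v, Measurable fun a => rootExt x (r a) v :=
    fun v => (measurable_rootExt x v).comp hr
  have h1 := measurable_sprod hR
  have h2 := measurable_ratioSum hR
  have h3 := measurable_tau G fun e => (hw e).div (h1 e)
  have h4 : ∀ i, Measurable fun a => r a i := fun i => (measurable_pi_apply i).comp hr
  unfold jointDensity
  refine (Finset.measurable_prod _ fun e _ => (hw e).pow_const _).mul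
    (((Finset.measurable_prod _ fun i _ => h4 i).mul h3.sqrt).mul
    (Finset.measurable_sum _ fun e _ => (hw e).mul (h2 e)).neg.exp)

theorem lintegral_lintegral_jointDensity (hG : G.Connected) (he0 : e0 ∈ G.edgeFinset) (x : V)
    {B : Sym2 V → ℝ} (hB : ∀ e ∈ G.edgeFinset, 0 < B e) :
    ∫⁻ p, ∫⁻ r, ENNReal.ofReal (jointDensity G x B (coordExt G e0 p) r)
      ∂(Measure.pi fun _ => mulHaar) ∂coordHaar G e0 =
    ENNReal.ofReal (√π ^ (Fintype.card V - 1) *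
      ∏ e ∈ G.edgeFinset, 2 ^ (-B e) * Real.Gamma (B e)) := by
  have h1 : ∀ᵐ p ∂coordHaar G e0, ∫⁻ r, ENNReal.ofReal (jointDensity G x B (coordExt G e0 p) r)
      ∂(Measure.pi fun _ => mulHaar) = ENNReal.ofReal (√π ^ (Fintype.card V - 1)) *
        ∏ e ∈ G.edgeFinset, ENNReal.ofReal (coordExt G e0 p e ^ B e *
          Real.exp (-2 * coordExt G e0 p e ^ (1 : ℝ))) := by
    filter_upwards [ae_coordHaar_pos] with p hp
    have hw := coordExt_pos hp.1 hp.2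
    have hprod : 0 ≤ ∏ e ∈ G.edgeFinset, coordExt G e0 p e ^ B e :=
      Finset.prod_nonneg fun e he => (Real.rpow_pos_of_pos (hw e he) _).le
    simp_rw [jointDensity, ENNReal.ofReal_mul hprod]
    rw [lintegral_const_mul' _ _ ENNReal.ofReal_ne_top, lintegral_sqrt_tau_mul_exp hG x hw,
      ← ENNReal.ofReal_mul hprod, ← ENNReal.ofReal_prod_of_nonneg fun e he =>
        mul_nonneg (Real.rpow_pos_of_pos (hw e he) _).le (Real.exp_pos _).le,
      ← ENNReal.ofReal_mul (by positivity), Finset.prod_mul_distrib, ← Real.exp_sum]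
    simp_rw [Real.rpow_one, ← Finset.mul_sum, neg_mul]
    congr 1
    ring
  rw [lintegral_congr_ae h1, lintegral_const_mul' _ _ ENNReal.ofReal_ne_top,
    lintegral_prod_coordExt he0 (f := fun e t => ENNReal.ofReal (t ^ B e *
      Real.exp (-2 * t ^ (1 : ℝ)))) fun e => by fun_prop,
    ENNReal.ofReal_mul (by positivity), ENNReal.ofReal_prod_of_nonneg fun e he =>
      mul_nonneg (by positivity) (Real.Gamma_pos_of_pos (hB e he)).le]
  congr 1
  refine Finset.prod_congr rfl fun e he => ?_
  rw [lintegral_mulHaar_rpow_mul_exp one_pos (hB e he) two_pos]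
  simp

theorem jointDensity_sprod_mul (x : V) (B w : Sym2 V → ℝ)
    (hw : ∀ e ∈ G.edgeFinset, 0 < w e) {r : {v // v ≠ x} → ℝ} (hr : ∀ i, 0 < r i) :
    jointDensity G x B (fun e => sprod (rootExt x r) e * w e) r =
      (∏ i : {v // v ≠ x}, r i ^ (vw G B i + 1) * Real.exp (-vw G w i * r i ^ (2 : ℝ))) *
        (Real.exp (-vw G w x) * (∏ e ∈ G.edgeFinset, w e ^ B e) * √(tau G w)) := by
  have hR := rootExt_pos hr
  have hs := sprod_pos hR
  have h1 : ∏ e ∈ G.edgeFinset, (sprod (rootExt x r) e * w e) ^ B e =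
      (∏ i : {v // v ≠ x}, r i ^ vw G B i) * ∏ e ∈ G.edgeFinset, w e ^ B e := by
    rw [Finset.prod_congr rfl fun e he => Real.mul_rpow (hs e).le (hw e he).le,
      Finset.prod_mul_distrib, prod_sprod_rpow G B hR, prod_eq_mul_prod_ne x]
    simp
  have h2 : (fun e => sprod (rootExt x r) e * w e / sprod (rootExt x r) e) = w :=
    funext fun e => mul_div_cancel_left₀ _ (hs e).ne'
  rw [jointDensity, h1, h2, sum_sprod_mul_ratioSum G w hR, sum_eq_add_sum_ne x]
  simp_rw [Real.rpow_add_one (hr _).ne', Finset.prod_mul_distrib, ← Real.exp_sum, neg_mul,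
    Finset.sum_neg_distrib, rootExt_root, rootExt_coe, neg_add, Real.exp_add]
  simp only [one_pow, one_mul, Real.rpow_two, mul_comm (vw G w _)]
  ring

theorem lintegral_prod_rpow_mul_exp (x : V) {B w : Sym2 V → ℝ}
    (hB : ∀ v, 0 < vw G B v) (hw : ∀ v, 0 < vw G w v) :
    ∫⁻ r : {v // v ≠ x} → ℝ, ENNReal.ofReal
        (∏ i, r i ^ (vw G B i + 1) * Real.exp (-vw G w i * r i ^ (2 : ℝ)))
      ∂(Measure.pi fun _ => mulHaar) =
    ENNReal.ofReal (∏ i : {v // v ≠ x}, vw G w i ^ (-((vw G B i + 1) / 2)) *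
      (1 / 2 * Real.Gamma ((vw G B i + 1) / 2))) := by
  have h1 : ∀ i, 0 < (vw G B i + 1) / 2 := fun i => by have := hB i; positivity
  have h2 : ∀ᵐ r : {v // v ≠ x} → ℝ ∂(Measure.pi fun _ => mulHaar), ENNReal.ofReal
      (∏ i, r i ^ (vw G B i + 1) * Real.exp (-vw G w i * r i ^ (2 : ℝ))) =
      ∏ i, ENNReal.ofReal (r i ^ (vw G B i + 1) * Real.exp (-vw G w i * r i ^ (2 : ℝ))) := by
    filter_upwards [ae_pi_mulHaar_pos] with r hr
    exact ENNReal.ofReal_prod_of_nonneg fun i _ =>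
      mul_nonneg (Real.rpow_pos_of_pos (hr i) _).le (Real.exp_pos _).le
  rw [lintegral_congr_ae h2, lintegral_pi_finset_prod mulHaar (fun (i : {v // v ≠ x}) t =>
      ENNReal.ofReal (t ^ (vw G B i + 1) * Real.exp (-vw G w i * t ^ (2 : ℝ))))
      (fun i => by fun_prop),
    ENNReal.ofReal_prod_of_nonneg fun (i : {v // v ≠ x}) _ =>
      mul_nonneg (Real.rpow_pos_of_pos (hw i) _).le
      (mul_nonneg (by norm_num) (Real.Gamma_pos_of_pos (h1 i)).le)]
  refine Finset.prod_congr rfl fun i _ => ?_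
  rw [lintegral_mulHaar_rpow_mul_exp two_pos (by have := hB i; positivity) (hw i), neg_div,
    mul_assoc]

omit [DecidableEq V] in
theorem vw_pos (hG : G.Connected) (he0 : e0 ∈ G.edgeFinset) {w : Sym2 V → ℝ}
    (hw : ∀ e ∈ G.edgeFinset, 0 < w e) (v : V) : 0 < vw G w v := by
  have : Nontrivial V := by
    induction e0 with | _ a b =>
    exact ⟨a, b, G.ne_of_adj (by simpa using he0)⟩
  obtain ⟨u, hu⟩ := hG.preconnected.exists_adj_of_nontrivial v
  exact Finset.sum_pos (fun j hj => hw _ (by simpa using hj)) ⟨u, by simpa using hu⟩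

theorem measurable_pinExt : Measurable (pinExt G e0) :=
  measurable_pi_lambda _ fun e =>
    (measurable_coordExt (G := G) (e0 := e0) e).comp (measurable_prodMk_left (x := (1 : ℝ)))

theorem pinExt_coe (u : Epin G e0 → ℝ) (e : Epin G e0) : pinExt G e0 u e = u e :=
  coordExt_coe (1, u) e

theorem pinExt_self (u : Epin G e0 → ℝ) : pinExt G e0 u e0 = 1 :=
  coordExt_self (1, u)

theorem pinExt_pos {u : Epin G e0 → ℝ} (hu : ∀ e, 0 < u e) :
    ∀ e ∈ G.edgeFinset, 0 < pinExt G e0 u e :=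
  coordExt_pos (p := (1, u)) one_pos hu

theorem lintegral_coordHaar_eq_radial {F : (Sym2 V → ℝ) → ℝ≥0∞} (hF : Measurable F) :
    ∫⁻ p, F (coordExt G e0 p) ∂coordHaar G e0 =
      ∫⁻ u, ∫⁻ t, F (fun e => t * pinExt G e0 u e) ∂mulHaar
        ∂(Measure.pi fun _ => mulHaar) := by
  have hm : Measurable fun p => F (coordExt G e0 p) :=
    hF.comp (measurable_pi_lambda _ measurable_coordExt)
  have hm' : Measurable fun p : ℝ × (Epin G e0 → ℝ) =>
      F (fun e => p.1 * pinExt G e0 p.2 e) :=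
    hF.comp (measurable_pi_lambda _ fun e => measurable_fst.mul
      ((measurable_pi_apply e).comp (measurable_pinExt.comp measurable_snd)))
  rw [coordHaar, lintegral_prod _ hm.aemeasurable,
    ← lintegral_lintegral_swap (f := fun t u => F (fun e => t * pinExt G e0 u e))
      hm'.aemeasurable]
  refine lintegral_congr_ae ?_
  filter_upwards [ae_mulHaar_pos] with t ht
  refine ((measurePreserving_mul_pi_mulHaar fun _ => ht).lintegral_comp
    (hm.comp (measurable_prodMk_left (x := t)))).symm.trans ?_
  refine lintegral_congr fun u => ?_
  have := coordExt_mul (fun _ => t) ((1, u) : ℝ × (Epin G e0 → ℝ))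
  rw [mul_one] at this
  simp only [Function.comp_apply]
  rw [this]
  rfl

/-- The density of environments after integrating out the mixing field. -/
def envDensity (G : SimpleGraph V) [DecidableRel G.Adj] (x : V) (B w : Sym2 V → ℝ) : ℝ :=
  (∏ i : {v // v ≠ x}, vw G w i ^ (-((vw G B i + 1) / 2)) *
      (1 / 2 * Real.Gamma ((vw G B i + 1) / 2))) *
    ((∏ e ∈ G.edgeFinset, w e ^ B e) * √(tau G w))

theorem envDensity_nonneg (hG : G.Connected) (he0 : e0 ∈ G.edgeFinset) (x : V)
    {B w : Sym2 V → ℝ} (hB : ∀ e ∈ G.edgeFinset, 0 < B e) (hw : ∀ e ∈ G.edgeFinset, 0 < w e) :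
    0 ≤ envDensity G x B w := by
  have h1 := vw_pos hG he0 hB
  have h2 := vw_pos hG he0 hw
  refine mul_nonneg (Finset.prod_nonneg fun i _ => mul_nonneg
    (Real.rpow_pos_of_pos (h2 i) _).le (mul_nonneg (by norm_num)
    (Real.Gamma_pos_of_pos ?_).le)) (mul_nonneg (Finset.prod_nonneg fun e he =>
    (Real.rpow_pos_of_pos (hw e he) _).le) (Real.sqrt_nonneg _))
  have := h1 i
  positivity

theorem measurable_envDensity (x : V) (B : Sym2 V → ℝ) : Measurable (envDensity G x B) := by
  have h1 : ∀ e : Sym2 V, Measurable fun w : Sym2 V → ℝ => w e := measurable_pi_apply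
  unfold envDensity
  exact Measurable.mul (Finset.measurable_prod _ fun i _ =>
    ((measurable_vw G h1 i).pow_const _).mul_const _)
    ((Finset.measurable_prod _ fun e _ => (h1 e).pow_const _).mul (measurable_tau G h1).sqrt)

theorem lintegral_envDensity_mul_exp (hG : G.Connected) (he0 : e0 ∈ G.edgeFinset) (x : V)
    {B : Sym2 V → ℝ} (hB : ∀ e ∈ G.edgeFinset, 0 < B e) :
    ∫⁻ p, ENNReal.ofReal (envDensity G x B (coordExt G e0 p) *
        Real.exp (-vw G (coordExt G e0 p) x)) ∂coordHaar G e0 =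
    ENNReal.ofReal (√π ^ (Fintype.card V - 1) *
      ∏ e ∈ G.edgeFinset, 2 ^ (-B e) * Real.Gamma (B e)) := by
  have hBv := vw_pos hG he0 hB
  have hm : Measurable fun z : (ℝ × (Epin G e0 → ℝ)) × ({v // v ≠ x} → ℝ) =>
      ENNReal.ofReal (jointDensity G x B (coordExt G e0 z.1) z.2) :=
    (measurable_jointDensity x B (fun e => (measurable_coordExt e).comp measurable_fst)
      measurable_snd).ennreal_ofReal
  have hm' : Measurable fun z : (ℝ × (Epin G e0 → ℝ)) × ({v // v ≠ x} → ℝ) =>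
      ENNReal.ofReal ((∏ i : {v // v ≠ x}, z.2 i ^ (vw G B i + 1) *
          Real.exp (-vw G (coordExt G e0 z.1) i * z.2 i ^ (2 : ℝ))) *
        (Real.exp (-vw G (coordExt G e0 z.1) x) *
          (∏ e ∈ G.edgeFinset, coordExt G e0 z.1 e ^ B e) * √(tau G (coordExt G e0 z.1)))) := by
    have h1 : ∀ e, Measurable fun z : (ℝ × (Epin G e0 → ℝ)) × ({v // v ≠ x} → ℝ) =>
        coordExt G e0 z.1 e := fun e => (measurable_coordExt e).comp measurable_fst
    have h2 := measurable_vw G h1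
    have h3 := measurable_tau G h1
    have h4 : ∀ i, Measurable fun z : (ℝ × (Epin G e0 → ℝ)) × ({v // v ≠ x} → ℝ) => z.2 i :=
      fun i => (measurable_pi_apply i).comp measurable_snd
    exact ((Finset.measurable_prod _ fun i _ => ((h4 i).pow_const _).mul
      ((h2 i).neg.mul ((h4 i).pow_const _)).exp).mul
      (((h2 x).neg.exp.mul (Finset.measurable_prod _ fun e _ =>
        (h1 e).pow_const _)).mul h3.sqrt)).ennreal_ofReal
  rw [← lintegral_lintegral_jointDensity hG he0 x hB, lintegral_lintegral_swap hm.aemeasurable]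
  have hscale : ∀ᵐ r : {v // v ≠ x} → ℝ ∂(Measure.pi fun _ => mulHaar),
      ∫⁻ p, ENNReal.ofReal (jointDensity G x B (coordExt G e0 p) r) ∂coordHaar G e0 =
      ∫⁻ p, ENNReal.ofReal ((∏ i : {v // v ≠ x}, r i ^ (vw G B i + 1) *
          Real.exp (-vw G (coordExt G e0 p) i * r i ^ (2 : ℝ))) *
        (Real.exp (-vw G (coordExt G e0 p) x) *
          (∏ e ∈ G.edgeFinset, coordExt G e0 p e ^ B e) * √(tau G (coordExt G e0 p))))
        ∂coordHaar G e0 := by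
    filter_upwards [ae_pi_mulHaar_pos] with r hr
    refine ((measurePreserving_mul_coordHaar (G := G) (e0 := e0)
      (sprod_pos (rootExt_pos hr))).lintegral_comp
      (hm.comp (measurable_prodMk_right (y := r)))).symm.trans ?_
    refine lintegral_congr_ae ?_
    filter_upwards [ae_coordHaar_pos] with p hp
    simp only [Function.comp_apply]
    rw [coordExt_mul, jointDensity_sprod_mul x B _ (coordExt_pos hp.1 hp.2) hr]
  rw [lintegral_congr_ae hscale, ← lintegral_lintegral_swap hm'.aemeasurable]
  refine lintegral_congr_ae ?_
  filter_upwards [ae_coordHaar_pos] with p hp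
  have hw := coordExt_pos hp.1 hp.2
  have hwv := vw_pos hG he0 hw
  have hnn : 0 ≤ Real.exp (-vw G (coordExt G e0 p) x) *
      (∏ e ∈ G.edgeFinset, coordExt G e0 p e ^ B e) * √(tau G (coordExt G e0 p)) :=
    mul_nonneg (mul_nonneg (Real.exp_pos _).le (Finset.prod_nonneg fun e he =>
      (Real.rpow_pos_of_pos (hw e he) _).le)) (Real.sqrt_nonneg _)
  simp_rw [ENNReal.ofReal_mul' hnn]
  rw [lintegral_mul_const' _ _ ENNReal.ofReal_ne_top, lintegral_prod_rpow_mul_exp x hBv hwv,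
    ← ENNReal.ofReal_mul' hnn, envDensity]
  congr 1
  ring

theorem envDensity_const_mul (x : V) {B w : Sym2 V → ℝ} (hwv : ∀ v, 0 < vw G w v)
    (hw : ∀ e ∈ G.edgeFinset, 0 < w e) {t : ℝ} (ht : 0 < t) :
    envDensity G x B (fun e => t * w e) = t ^ (vw G B x / 2) * envDensity G x B w := by
  have hv : ∀ v, vw G (fun e => t * w e) v = t * vw G w v := fun v => by
    simp only [vw, Finset.mul_sum]
  have h1 : ∏ e ∈ G.edgeFinset, (t * w e) ^ B e =
      t ^ (∑ e ∈ G.edgeFinset, B e) * ∏ e ∈ G.edgeFinset, w e ^ B e := by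
    rw [Real.rpow_sum_of_pos ht, ← Finset.prod_mul_distrib]
    exact Finset.prod_congr rfl fun e he => Real.mul_rpow ht.le (hw e he).le
  have h2 : ∏ i : {v // v ≠ x}, (t * vw G w i) ^ (-((vw G B i + 1) / 2)) *
      (1 / 2 * Real.Gamma ((vw G B i + 1) / 2)) =
      t ^ (∑ i : {v // v ≠ x}, -((vw G B i + 1) / 2)) *
      ∏ i : {v // v ≠ x}, vw G w i ^ (-((vw G B i + 1) / 2)) *
      (1 / 2 * Real.Gamma ((vw G B i + 1) / 2)) := by
    rw [Real.rpow_sum_of_pos ht, ← Finset.prod_mul_distrib]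
    refine Finset.prod_congr rfl fun i _ => ?_
    rw [Real.mul_rpow ht.le (hwv i).le, mul_assoc]
  have h3 : √(t ^ (Fintype.card V - 1)) = t ^ ((Fintype.card {v // v ≠ x} : ℝ) / 2) := by
    rw [Fintype.card_subtype_compl, Fintype.card_subtype_eq, Real.sqrt_eq_rpow,
      ← Real.rpow_natCast_mul ht.le, mul_one_div]
  have h4 : vw G B x / 2 = ∑ i : {v // v ≠ x}, -((vw G B i + 1) / 2) +
      (∑ e ∈ G.edgeFinset, B e + (Fintype.card {v // v ≠ x} : ℝ) / 2) := by
    have h5 := sum_vw G B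
    rw [sum_eq_add_sum_ne x] at h5
    simp only [neg_add_rev, add_div, Finset.sum_add_distrib, Finset.sum_neg_distrib,
      ← Finset.sum_div, Finset.sum_const, Finset.card_univ, nsmul_eq_mul]
    linarith
  simp only [envDensity, hv]
  rw [h1, h2, tau_const_mul, Real.sqrt_mul (by positivity), h3, h4, Real.rpow_add ht,
    Real.rpow_add ht]
  ring

theorem lintegral_pinned_envDensity (hG : G.Connected) (he0 : e0 ∈ G.edgeFinset) (x : V)
    {B : Sym2 V → ℝ} (hB : ∀ e ∈ G.edgeFinset, 0 < B e) :
    ∫⁻ u, ENNReal.ofReal (envDensity G x B (pinExt G e0 u) *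
        (vw G (pinExt G e0 u) x ^ (-(vw G B x / 2)) * Real.Gamma (vw G B x / 2)))
      ∂(Measure.pi fun _ => mulHaar) =
    ENNReal.ofReal (√π ^ (Fintype.card V - 1) *
      ∏ e ∈ G.edgeFinset, 2 ^ (-B e) * Real.Gamma (B e)) := by
  have hm : Measurable fun w : Sym2 V → ℝ =>
      ENNReal.ofReal (envDensity G x B w * Real.exp (-vw G w x)) :=
    ((measurable_envDensity x B).mul
      (measurable_vw G measurable_pi_apply x).neg.exp).ennreal_ofReal
  rw [← lintegral_envDensity_mul_exp hG he0 x hB, lintegral_coordHaar_eq_radial hm]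
  refine lintegral_congr_ae ?_
  filter_upwards [ae_pi_mulHaar_pos] with u hu
  have hw := pinExt_pos hu
  have hwv := vw_pos hG he0 hw
  have hBx := vw_pos hG he0 hB x
  have hv : ∀ t, vw G (fun e => t * pinExt G e0 u e) x = t * vw G (pinExt G e0 u) x :=
    fun t => by simp only [vw, Finset.mul_sum]
  have h1 : ∀ᵐ t ∂mulHaar, ENNReal.ofReal (envDensity G x B (fun e => t * pinExt G e0 u e) *
      Real.exp (-vw G (fun e => t * pinExt G e0 u e) x)) =
      ENNReal.ofReal (envDensity G x B (pinExt G e0 u)) * ENNReal.ofReal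
        (t ^ (vw G B x / 2) * Real.exp (-vw G (pinExt G e0 u) x * t ^ (1 : ℝ))) := by
    filter_upwards [ae_mulHaar_pos] with t ht
    rw [envDensity_const_mul x hwv hw ht, hv, ← ENNReal.ofReal_mul
      (envDensity_nonneg hG he0 x hB hw), Real.rpow_one]
    congr 1
    ring_nf
  rw [lintegral_congr_ae h1, lintegral_const_mul' _ _ ENNReal.ofReal_ne_top,
    lintegral_mulHaar_rpow_mul_exp one_pos (by positivity) (hwv x),
    ← ENNReal.ofReal_mul (envDensity_nonneg hG he0 x hB hw)]
  simp

theorem bwt_pos (hG : G.Connected) (he0 : e0 ∈ G.edgeFinset) (x : V) {B : Sym2 V → ℝ}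
    (hB : ∀ e ∈ G.edgeFinset, 0 < B e) (v : V) : 0 < bwt G x B v := by
  have := vw_pos hG he0 hB v
  unfold bwt
  split_ifs <;> linarith

theorem Znorm_pos (hG : G.Connected) (he0 : e0 ∈ G.edgeFinset) (x : V) {B : Sym2 V → ℝ}
    (hB : ∀ e ∈ G.edgeFinset, 0 < B e) : 0 < Znorm G x B := by
  have h1 : 0 < ∏ e ∈ G.edgeFinset, Real.Gamma (B e) :=
    Finset.prod_pos fun e he => Real.Gamma_pos_of_pos (hB e he)
  have h2 : 0 < ∏ v, Real.Gamma (bwt G x B v) :=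
    Finset.prod_pos fun v _ => Real.Gamma_pos_of_pos (bwt_pos hG he0 x hB v)
  unfold Znorm
  positivity

theorem Znorm_mul_prod_Gamma (hG : G.Connected) (he0 : e0 ∈ G.edgeFinset) (x : V)
    {B : Sym2 V → ℝ} (hB : ∀ e ∈ G.edgeFinset, 0 < B e) :
    Znorm G x B * ((∏ i : {v // v ≠ x}, (1 / 2 * Real.Gamma ((vw G B i + 1) / 2))) *
      Real.Gamma (vw G B x / 2)) =
    √π ^ (Fintype.card V - 1) * ∏ e ∈ G.edgeFinset, 2 ^ (-B e) * Real.Gamma (B e) := by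
  have hcard : ((Fintype.card V - 1 : ℕ) : ℝ) = (Fintype.card V : ℝ) - 1 := by
    rw [Nat.cast_sub (Fintype.card_pos_iff.2 ⟨x⟩), Nat.cast_one]
  have h1 : ∏ v, Real.Gamma (bwt G x B v) = Real.Gamma (vw G B x / 2) *
      ∏ i : {v // v ≠ x}, Real.Gamma ((vw G B i + 1) / 2) := by
    rw [prod_eq_mul_prod_ne x]
    congr 1
    · simp [bwt]
    · exact Finset.prod_congr rfl fun i _ => by simp [bwt, i.2]
  have h2 : (0 : ℝ) < ∏ v, Real.Gamma (bwt G x B v) :=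
    Finset.prod_pos fun v _ => Real.Gamma_pos_of_pos (bwt_pos hG he0 x hB v)
  have h3 : π ^ (((Fintype.card V : ℝ) - 1) / 2) = √π ^ (Fintype.card V - 1) := by
    rw [Real.sqrt_eq_rpow, ← Real.rpow_mul_natCast pi_pos.le, hcard]
    ring_nf
  have h4 : (2 : ℝ) ^ ((1 : ℝ) - (Fintype.card V : ℝ) + ∑ e ∈ G.edgeFinset, B e) =
      ((2 : ℝ) ^ (Fintype.card V - 1))⁻¹ * (∏ e ∈ G.edgeFinset, (2 : ℝ) ^ (-B e))⁻¹ := by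
    rw [Real.rpow_add two_pos, ← Real.rpow_sum_of_pos two_pos, ← Real.rpow_neg two_pos.le,
      ← Real.rpow_natCast, ← Real.rpow_neg two_pos.le, hcard, Finset.sum_neg_distrib, neg_neg,
      neg_sub]
  have h5 : (0 : ℝ) < ∏ e ∈ G.edgeFinset, (2 : ℝ) ^ (-B e) :=
    Finset.prod_pos fun e _ => by positivity
  rw [h1] at h2
  rw [Znorm, h1, h3, h4, Finset.prod_mul_distrib, Finset.prod_mul_distrib, Finset.prod_const,
    Finset.card_univ, Fintype.card_subtype_compl, Fintype.card_subtype_eq]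
  have h6 := left_ne_zero_of_mul h2.ne'
  have h7 := right_ne_zero_of_mul h2.ne'
  field_simp
  simp

theorem magicDensity_mul_prod (hG : G.Connected) (he0 : e0 ∈ G.edgeFinset) (x : V)
    {B : Sym2 V → ℝ} (hB : ∀ e ∈ G.edgeFinset, 0 < B e) {u : Epin G e0 → ℝ}
    (hu : ∀ e, 0 < u e) :
    (∏ e, u e) * magicDensity G x B (pinExt G e0 u) =
      (√π ^ (Fintype.card V - 1) * ∏ e ∈ G.edgeFinset, 2 ^ (-B e) * Real.Gamma (B e))⁻¹ *
      (envDensity G x B (pinExt G e0 u) *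
        (vw G (pinExt G e0 u) x ^ (-(vw G B x / 2)) * Real.Gamma (vw G B x / 2))) := by
  have hw := pinExt_pos hu
  have hwv := vw_pos hG he0 hw
  have hBv := vw_pos hG he0 hB
  have hZ := (Znorm_pos hG he0 x hB).ne'
  have hK : (∏ i : {v // v ≠ x}, (1 / 2 * Real.Gamma ((vw G B i + 1) / 2))) ≠ 0 :=
    Finset.prod_ne_zero_iff.2 fun i _ => mul_ne_zero (by norm_num)
      (Real.Gamma_pos_of_pos (by have := hBv i; positivity)).ne'
  have hK' : Real.Gamma (vw G B x / 2) ≠ 0 :=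
    (Real.Gamma_pos_of_pos (by have := hBv x; positivity)).ne'
  have h1 : (∏ e, u e) * ∏ e ∈ G.edgeFinset, pinExt G e0 u e ^ (B e - 1) =
      ∏ e ∈ G.edgeFinset, pinExt G e0 u e ^ B e := by
    rw [prod_edgeFinset he0, prod_edgeFinset he0, pinExt_self, Real.one_rpow, Real.one_rpow,
      one_mul, one_mul, ← Finset.prod_mul_distrib]
    refine Finset.prod_congr rfl fun e _ => ?_
    rw [pinExt_coe, Real.rpow_sub_one (hu e).ne', mul_div_cancel₀ _ (hu e).ne']
  have h2 : (∏ v, vw G (pinExt G e0 u) v ^ ((vw G B v + 1) / 2))⁻¹ =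
      vw G (pinExt G e0 u) x ^ (-((vw G B x + 1) / 2)) *
      ∏ i : {v // v ≠ x}, vw G (pinExt G e0 u) i ^ (-((vw G B i + 1) / 2)) := by
    rw [← Finset.prod_inv_distrib, prod_eq_mul_prod_ne x]
    simp_rw [Real.rpow_neg (hwv _).le]
  have h3 : vw G (pinExt G e0 u) x ^ (-(vw G B x / 2)) =
      vw G (pinExt G e0 u) x ^ ((1 : ℝ) / 2) *
        vw G (pinExt G e0 u) x ^ (-((vw G B x + 1) / 2)) := by
    rw [← Real.rpow_add (hwv x)]
    congr 1
    ring
  have h4 : ∏ i : {v // v ≠ x}, vw G (pinExt G e0 u) i ^ (-((vw G B i + 1) / 2)) *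
      (1 / 2 * Real.Gamma ((vw G B i + 1) / 2)) =
      (∏ i : {v // v ≠ x}, vw G (pinExt G e0 u) i ^ (-((vw G B i + 1) / 2))) *
        ∏ i : {v // v ≠ x}, (1 / 2 * Real.Gamma ((vw G B i + 1) / 2)) :=
    Finset.prod_mul_distrib
  rw [← Znorm_mul_prod_Gamma hG he0 x hB, magicDensity, envDensity, h4, div_eq_mul_inv, h2, ← h1,
    h3]
  generalize (∏ i : {v // v ≠ x}, (1 / 2 * Real.Gamma ((vw G B i + 1) / 2))) = K at hK ⊢
  field_simp

theorem forall_pinExt_pos_iff {u : Epin G e0 → ℝ} :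
    (∀ e ∈ G.edgeFinset, 0 < pinExt G e0 u e) ↔ u ∈ Set.univ.pi fun _ => Set.Ioi 0 := by
  rw [Set.mem_univ_pi]
  exact ⟨fun h e => pinExt_coe u e ▸ h e e.2.1, fun h => pinExt_pos h⟩

theorem measurable_magicDensity (x : V) (B : Sym2 V → ℝ) : Measurable (magicDensity G x B) := by
  have h1 : ∀ e : Sym2 V, Measurable fun w : Sym2 V → ℝ => w e := measurable_pi_apply
  have h2 := measurable_vw G h1
  exact (((((h2 x).pow_const _).const_mul _).mul
    (Finset.measurable_prod _ fun e _ => (h1 e).pow_const _)).div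
    (Finset.measurable_prod _ fun v _ => (h2 v).pow_const _)).mul (measurable_tau G h1).sqrt

/-- The magic formula: the mixing measure is a probability measure. -/
theorem mixing_univ (hG : G.Connected) (he0 : e0 ∈ G.edgeFinset) (x : V)
    {B : Sym2 V → ℝ} (hB : ∀ e ∈ G.edgeFinset, 0 < B e) :
    mixing G e0 x B Set.univ = 1 := by
  have hmagic := (measurable_magicDensity (G := G) x B).comp (measurable_pinExt (G := G) (e0 := e0))
  have hK : 0 < √π ^ (Fintype.card V - 1) *
      ∏ e ∈ G.edgeFinset, 2 ^ (-B e) * Real.Gamma (B e) :=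
    mul_pos (by positivity) (Finset.prod_pos fun e he => mul_pos (by positivity)
      (Real.Gamma_pos_of_pos (hB e he)))
  have hset : MeasurableSet (Set.univ.pi fun _ : Epin G e0 => Set.Ioi (0 : ℝ)) :=
    MeasurableSet.univ_pi fun _ => measurableSet_Ioi
  have h1 : ∫⁻ u, ENNReal.ofReal ((∏ e, u e) * magicDensity G x B (pinExt G e0 u))
      ∂(Measure.pi fun _ => mulHaar) = 1 := by
    have h2 : ∀ᵐ u : Epin G e0 → ℝ ∂(Measure.pi fun _ => mulHaar),
        ENNReal.ofReal ((∏ e, u e) * magicDensity G x B (pinExt G e0 u)) =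
        ENNReal.ofReal (√π ^ (Fintype.card V - 1) *
          ∏ e ∈ G.edgeFinset, 2 ^ (-B e) * Real.Gamma (B e))⁻¹ *
        ENNReal.ofReal (envDensity G x B (pinExt G e0 u) *
          (vw G (pinExt G e0 u) x ^ (-(vw G B x / 2)) * Real.Gamma (vw G B x / 2))) := by
      filter_upwards [ae_pi_mulHaar_pos] with u hu
      rw [magicDensity_mul_prod hG he0 x hB hu, ENNReal.ofReal_mul (inv_pos.2 hK).le]
    rw [lintegral_congr_ae h2, lintegral_const_mul' _ _ ENNReal.ofReal_ne_top,
      lintegral_pinned_envDensity hG he0 x hB, ← ENNReal.ofReal_mul (inv_pos.2 hK).le,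
      inv_mul_cancel₀ hK.ne', ENNReal.ofReal_one]
  rw [mixing, Measure.map_apply measurable_pinExt MeasurableSet.univ, Set.preimage_univ,
    withDensity_apply _ MeasurableSet.univ, Measure.restrict_univ, ← h1, lintegral_pi_mulHaar,
    ← lintegral_indicator hset]
  · refine lintegral_congr fun u => ?_
    by_cases hu : u ∈ Set.univ.pi fun _ : Epin G e0 => Set.Ioi (0 : ℝ)
    · rw [Set.indicator_of_mem hu, if_pos (forall_pinExt_pos_iff.2 hu)]
      have hu' : ∀ e, 0 < u e := fun e => hu e trivial
      rw [← ENNReal.ofReal_prod_of_nonneg fun e _ => (inv_pos.2 (hu' e)).le,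
        ← ENNReal.ofReal_mul (Finset.prod_nonneg fun e _ => (inv_pos.2 (hu' e)).le),
        ← mul_assoc, ← Finset.prod_mul_distrib,
        Finset.prod_eq_one fun e _ => inv_mul_cancel₀ (hu' e).ne', one_mul]
    · rw [Set.indicator_of_notMem hu, if_neg fun h => hu (forall_pinExt_pos_iff.1 h),
        ENNReal.ofReal_zero]
  · exact ((Finset.measurable_prod _ fun e _ => measurable_pi_apply e).mul hmagic).ennreal_ofReal

end MagicFormula

section PathUpdate

variable {G : SimpleGraph V} [DecidableRel G.Adj] {e0 : Sym2 V}

theorem vw_add_indicator {i j : V} (hij : G.Adj i j) (B : Sym2 V → ℝ) (v : V) :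
    vw G (fun e => B e + if s(i, j) = e then 1 else 0) v =
      vw G B v + ((if i = v then 1 else 0) + if j = v then 1 else 0) := by
  have hne := G.ne_of_adj hij
  simp only [vw, Finset.sum_add_distrib, add_right_inj]
  by_cases hi : i = v
  · subst hi
    simp [hne.symm, hij]
  · by_cases hj : j = v
    · subst hj
      simp [Sym2.eq_swap (a := i), hne, hij.symm]
    · rw [if_neg hi, if_neg hj, add_zero]
      refine Finset.sum_eq_zero fun k _ => if_neg ?_
      simp [hi, hj]

theorem Znorm_mul_magicDensity_mul_qstep (hG : G.Connected) (he0 : e0 ∈ G.edgeFinset)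
    {B w : Sym2 V → ℝ} (hB : ∀ e ∈ G.edgeFinset, 0 < B e) (hw : ∀ e ∈ G.edgeFinset, 0 < w e)
    {i j : V} (hij : G.Adj i j) :
    Znorm G i B * magicDensity G i B w * qstep G w i j =
      Znorm G j (fun e => B e + if s(i, j) = e then 1 else 0) *
        magicDensity G j (fun e => B e + if s(i, j) = e then 1 else 0) w := by
  have hB' : ∀ e ∈ G.edgeFinset, 0 < B e + if s(i, j) = e then (1 : ℝ) else 0 := fun e he =>
    add_pos_of_pos_of_nonneg (hB e he) (by split_ifs <;> norm_num)
  have hmem : s(i, j) ∈ G.edgeFinset := by simpa using hij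
  have hwv := vw_pos hG he0 hw
  have hedges : ∏ e ∈ G.edgeFinset, w e ^ (B e + (if s(i, j) = e then (1 : ℝ) else 0) - 1) =
      (∏ e ∈ G.edgeFinset, w e ^ (B e - 1)) * w s(i, j) := by
    rw [← Finset.prod_ite_eq_of_mem G.edgeFinset s(i, j) w hmem, ← Finset.prod_mul_distrib]
    refine Finset.prod_congr rfl fun e he => ?_
    rw [add_sub_right_comm, Real.rpow_add (hw e he)]
    split_ifs <;> simp
  have hvert : ∏ v, vw G w v ^ ((vw G (fun e => B e + if s(i, j) = e then 1 else 0) v + 1) / 2) =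
      (∏ v, vw G w v ^ ((vw G B v + 1) / 2)) *
        (vw G w i ^ ((1 : ℝ) / 2) * vw G w j ^ ((1 : ℝ) / 2)) := by
    rw [← Finset.prod_ite_eq_of_mem Finset.univ i (fun v => vw G w v ^ ((1 : ℝ) / 2))
        (Finset.mem_univ i),
      ← Finset.prod_ite_eq_of_mem Finset.univ j (fun v => vw G w v ^ ((1 : ℝ) / 2))
        (Finset.mem_univ j), ← Finset.prod_mul_distrib, ← Finset.prod_mul_distrib]
    refine Finset.prod_congr rfl fun v _ => ?_
    rw [vw_add_indicator hij, add_right_comm, add_div, add_div, Real.rpow_add (hwv v),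
      Real.rpow_add (hwv v)]
    split_ifs with h1 h2 h2
    · exact absurd (h1.trans h2.symm) (G.ne_of_adj hij)
    all_goals simp
  have hstep : qstep G w i j =
      w s(i, j) / (vw G w i ^ ((1 : ℝ) / 2) * vw G w i ^ ((1 : ℝ) / 2)) := by
    rw [qstep, if_pos hij, ← Real.rpow_add (hwv i), add_halves, Real.rpow_one]
  have hi : vw G w i ^ ((1 : ℝ) / 2) ≠ 0 := (Real.rpow_pos_of_pos (hwv i) _).ne'
  have hj : vw G w j ^ ((1 : ℝ) / 2) ≠ 0 := (Real.rpow_pos_of_pos (hwv j) _).ne'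
  have hprod : ∏ v, vw G w v ^ ((vw G B v + 1) / 2) ≠ 0 :=
    Finset.prod_ne_zero_iff.2 fun v _ => (Real.rpow_pos_of_pos (hwv v) _).ne'
  have hZ := (Znorm_pos hG he0 i hB).ne'
  have hZ' := (Znorm_pos hG he0 j hB').ne'
  rw [magicDensity, magicDensity, hedges, hvert, hstep]
  generalize ∏ v, vw G w v ^ ((vw G B v + 1) / 2) = P at hprod ⊢
  generalize vw G w i ^ ((1 : ℝ) / 2) = p at hi ⊢
  generalize vw G w j ^ ((1 : ℝ) / 2) = q at hj ⊢
  generalize Znorm G j _ = z at hZ' ⊢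
  field_simp

omit [Fintype V] in
theorem localTime_succ (a : Sym2 V → ℝ) (X : ℕ → V) (t : ℕ) :
    localTime a X (t + 1) =
      fun e => localTime a X t e + if s(X t, X (t + 1)) = e then 1 else 0 := by
  funext e
  simp only [localTime, Finset.range_add_one, Finset.filter_insert]
  split_ifs
  · rw [Finset.card_insert_of_notMem (by simp)]
    push_cast
    ring
  · simp

theorem localTime_pos {a : Sym2 V → ℝ} (ha : ∀ e ∈ G.edgeFinset, 0 < a e) (X : ℕ → V) (t : ℕ) :
    ∀ e ∈ G.edgeFinset, 0 < localTime a X t e := fun e he =>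
  add_pos_of_pos_of_nonneg (ha e he) (Nat.cast_nonneg _)

theorem Znorm_mul_magicDensity_mul_prod_qstep (hG : G.Connected) (he0 : e0 ∈ G.edgeFinset)
    {a w : Sym2 V → ℝ} (ha : ∀ e ∈ G.edgeFinset, 0 < a e) (hw : ∀ e ∈ G.edgeFinset, 0 < w e)
    {X : ℕ → V} {T : ℕ} (hX : ∀ t < T, G.Adj (X t) (X (t + 1))) :
    Znorm G (X 0) a * magicDensity G (X 0) a w *
        ∏ t ∈ Finset.range T, qstep G w (X t) (X (t + 1)) =
      Znorm G (X T) (localTime a X T) * magicDensity G (X T) (localTime a X T) w := by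
  induction T with
  | zero =>
    have : localTime a X 0 = a := by
      funext e
      simp [localTime]
    simp [this]
  | succ T ih =>
    rw [Finset.prod_range_succ, ← mul_assoc, ih fun t ht => hX t (by omega),
      Znorm_mul_magicDensity_mul_qstep hG he0 (localTime_pos ha X T) hw (hX T (by omega)),
      localTime_succ]

omit [DecidableEq V] in
theorem measurable_qstep (i j : V) : Measurable fun w : Sym2 V → ℝ => qstep G w i j := by
  unfold qstep
  split_ifs
  · exact (measurable_pi_apply _).div (measurable_vw G measurable_pi_apply i)
  · exact measurable_const

theorem mixing_withDensity_prod_qstep (hG : G.Connected) (he0 : e0 ∈ G.edgeFinset)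
    {a : Sym2 V → ℝ} (ha : ∀ e ∈ G.edgeFinset, 0 < a e)
    {X : ℕ → V} {T : ℕ} (hX : ∀ t < T, G.Adj (X t) (X (t + 1))) :
    ((mixing G e0 (X 0) a).withDensity fun w =>
        ENNReal.ofReal (∏ t ∈ Finset.range T, qstep G w (X t) (X (t + 1)))) =
      ENNReal.ofReal (Znorm G (X T) (localTime a X T) / Znorm G (X 0) a) •
        mixing G e0 (X T) (localTime a X T) := by
  have hZ := Znorm_pos hG he0 (X 0) ha
  have hZ' := Znorm_pos hG he0 (X T) (localTime_pos ha X T)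
  have hpin := measurable_pinExt (G := G) (e0 := e0)
  have hpos : MeasurableSet {u : Epin G e0 → ℝ | ∀ e ∈ G.edgeFinset, 0 < pinExt G e0 u e} := by
    have : {u : Epin G e0 → ℝ | ∀ e ∈ G.edgeFinset, 0 < pinExt G e0 u e} =
        Set.univ.pi fun _ => Set.Ioi 0 := Set.ext fun _ => forall_pinExt_pos_iff
    rw [this]
    exact MeasurableSet.univ_pi fun _ => measurableSet_Ioi
  have hdens : ∀ (x : V) (B : Sym2 V → ℝ), Measurable fun u : Epin G e0 → ℝ => ENNReal.ofReal
      (if ∀ e ∈ G.edgeFinset, 0 < pinExt G e0 u e then magicDensity G x B (pinExt G e0 u)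
        else 0) := fun x B =>
    (((measurable_magicDensity x B).comp hpin).ite hpos measurable_const).ennreal_ofReal
  have hlik : Measurable fun w : Sym2 V → ℝ =>
      ENNReal.ofReal (∏ t ∈ Finset.range T, qstep G w (X t) (X (t + 1))) :=
    (Finset.measurable_prod _ fun t _ => measurable_qstep _ _).ennreal_ofReal
  have hlik' : Measurable fun u : Epin G e0 → ℝ => ENNReal.ofReal
      (∏ t ∈ Finset.range T, qstep G (pinExt G e0 u) (X t) (X (t + 1))) := hlik.comp hpin
  ext s hs
  rw [withDensity_apply _ hs, mixing, mixing, setLIntegral_map hs hlik hpin,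
    setLIntegral_withDensity_eq_setLIntegral_mul _ (hdens _ _) hlik' (hpin hs),
    Measure.smul_apply, Measure.map_apply hpin hs, withDensity_apply _ (hpin hs), smul_eq_mul,
    ← lintegral_const_mul _ (hdens _ _)]
  refine lintegral_congr fun u => ?_
  simp only [Pi.mul_apply]
  split_ifs with hu
  · have hqstep : 0 ≤ ∏ t ∈ Finset.range T, qstep G (pinExt G e0 u) (X t) (X (t + 1)) :=
      Finset.prod_nonneg fun t ht => by
        have := hX t (Finset.mem_range.1 ht)
        rw [qstep, if_pos this]
        exact (div_pos (hu _ (by simpa using this)) (vw_pos hG he0 hu _)).le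
    rw [← ENNReal.ofReal_mul' hqstep, ← ENNReal.ofReal_mul (div_pos hZ' hZ).le, div_mul_eq_mul_div,
      ← Znorm_mul_magicDensity_mul_prod_qstep hG he0 ha hu hX, mul_assoc,
      mul_div_cancel_left₀ _ hZ.ne']
  · simp

end PathUpdate

/-- Posterior conjugacy.  For a path `x_0,…,x_T` with `x_0 = v0`, the
measure obtained from `μ_{v0,A}` by multiplying by the quenched path likelihood equals
`(Z_{x_T,A+N}/Z_{v0,A}) · μ_{x_T,A+N}`; in particular the normalized posterior of the
environment is `μ_{x_T,A+N}`: the parameters are updated by adding the undirected edge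
counts and moving the root to the endpoint of the path. -/
theorem posterior_conjugacy
    {V : Type*} [Fintype V] [DecidableEq V]
    (G : SimpleGraph V) [DecidableRel G.Adj] (hG : G.Connected)
    (v0 : V) (e0 : Sym2 V) (he0 : e0 ∈ G.edgeFinset)
    (a : Sym2 V → ℝ) (ha : ∀ e ∈ G.edgeFinset, 0 < a e)
    (T : ℕ) (hT : 1 ≤ T)
    (x : Fin (T + 1) → V) (hx0 : x 0 = v0)
    (hpath : ∀ t : ℕ, t < T → G.Adj (extendPath v0 x t) (extendPath v0 x (t + 1)))
    -- `ν` is the unnormalized posterior: the prior `μ_{v0,A}` multiplied by the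
    -- quenched path likelihood `w ↦ Π_{t=1}^T p_{x_{t−1} x_t}(w)`
    (ν : Measure (Sym2 V → ℝ))
    (hν : ν = (mixing G e0 v0 a).withDensity fun w =>
        ENNReal.ofReal (∏ t ∈ Finset.range T,
          qstep G w (extendPath v0 x t) (extendPath v0 x (t + 1)))) :
    ν = ENNReal.ofReal
          (Znorm G (x (Fin.last T)) (fun e => a e + (edgeCount v0 x e : ℝ)) / Znorm G v0 a) •
        mixing G e0 (x (Fin.last T)) (fun e => a e + (edgeCount v0 x e : ℝ)) ∧
    (ν Set.univ)⁻¹ • ν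
      = mixing G e0 (x (Fin.last T)) (fun e => a e + (edgeCount v0 x e : ℝ)) := by
  have hB := localTime_pos ha (extendPath v0 x) T
  have hstart : extendPath v0 x 0 = v0 := by simpa [extendPath] using hx0
  have hend : extendPath v0 x T = x (Fin.last T) := by simp [extendPath, Fin.last]
  have hc := ENNReal.ofReal_pos.2
    (div_pos (Znorm_pos hG he0 (x (Fin.last T)) hB) (Znorm_pos hG he0 v0 ha))
  have hmain := mixing_withDensity_prod_qstep hG he0 ha hpath
  rw [hstart, hend, ← hν] at hmain
  refine ⟨hmain, ?_⟩
  rw [hmain, Measure.smul_apply, mixing_univ hG he0 _ hB, smul_eq_mul, mul_one, smul_smul,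
    ENNReal.inv_mul_cancel hc.ne' ENNReal.ofReal_ne_top, one_smul]
  rfl

end ERRW
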